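/- arXiv:1610.09216 — 3 statements merged into one kernel-verified Lean document; each statement's English description precedes it below -/
import Mathlib

section
/- Let Ω ⊂ ℝⁿ be open and bounded and p > 2. Assume f : Ω × ℝ × ℝⁿ → ℝ is continuous, non-increasing in its second variable s, and locally Lipschitz continuous with respect to its third variable η. If u : Ω → ℝ is locally Lipschitz, is a weak supersolution of −Δ_p u = f(x,u,∇u) in Ω, and ∇u(x) ≠ 0 at every point x ∈ Ω at which u is differentiable, then u is a viscosity supersolution of −Δ_p u = f(x,u,∇u) in Ω. -/
open MeasureTheory Metric Set Filter
open scoped RealInnerProductSpace ENNReal Topology NNReal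

noncomputable section

abbrev Euc (n : ℕ) := EuclideanSpace ℝ (Fin n)

variable {n : ℕ}

/-- The p-Laplacian `Δ_p φ (x) = |∇φ|^{p-2} ( Δφ + (p-2)|∇φ|^{-2} ⟨D²φ ∇φ, ∇φ⟩ )` of a C² function
at a point where the gradient does not vanish (junk value elsewhere). -/
def pLap (p : ℝ) (φ : Euc n → ℝ) (x : Euc n) : ℝ :=
  ‖gradient φ x‖ ^ (p - 2) *
    ((LinearMap.trace ℝ (Euc n)) (fderiv ℝ (gradient φ) x).toLinearMap +
      ((p - 2) / ‖gradient φ x‖ ^ (2 : ℕ)) *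
        ⟪(fderiv ℝ (gradient φ) x) (gradient φ x), gradient φ x⟫)

/-- `lim_{r → 0} sup_{x ∈ B_r(x₀) \ {x₀}} g(x)`, as a monotone limit in the extended reals. -/
def limsupPunct (g : Euc n → ℝ) (x₀ : Euc n) : EReal :=
  ⨅ (r : ℝ) (_ : 0 < r), ⨆ x ∈ ball x₀ r \ {x₀}, (g x : EReal)

/-- Viscosity supersolution of `-Δ_p u = f(x, u, ∇u)` in an open set `Ω`. -/
def IsViscositySupersolution (p : ℝ) (f : Euc n → ℝ → Euc n → ℝ) (Ω : Set (Euc n))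
    (u : Euc n → ℝ) : Prop :=
  ∀ x₀ ∈ Ω, ∀ φ : Euc n → ℝ, ContDiffOn ℝ 2 φ Ω →
    φ x₀ = u x₀ → (∀ x ∈ Ω, φ x ≤ u x) → (∀ x ∈ Ω, x ≠ x₀ → gradient φ x ≠ 0) →
    (f x₀ (u x₀) (gradient φ x₀) : EReal) ≤ limsupPunct (fun x => -pLap p φ x) x₀

/-- Viscosity subsolution: `-u` is a viscosity supersolution of `-Δ_p v = -f(x, -v, -∇v)`. -/
def IsViscositySubsolution (p : ℝ) (f : Euc n → ℝ → Euc n → ℝ) (Ω : Set (Euc n))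
    (u : Euc n → ℝ) : Prop :=
  IsViscositySupersolution p (fun x s η => -(f x (-s) (-η))) Ω (fun x => -(u x))

def IsViscositySolution (p : ℝ) (f : Euc n → ℝ → Euc n → ℝ) (Ω : Set (Euc n))
    (u : Euc n → ℝ) : Prop :=
  IsViscositySupersolution p f Ω u ∧ IsViscositySubsolution p f Ω u

/-- Weak (distributional) supersolution of `-Δ_p u = f(x, u, ∇u)` in `Ω`, where `gradient u` is
the a.e.-defined pointwise gradient. -/
def IsWeakSupersolution (p : ℝ) (f : Euc n → ℝ → Euc n → ℝ) (Ω : Set (Euc n))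
    (u : Euc n → ℝ) : Prop :=
  ∀ ψ : Euc n → ℝ, ContDiff ℝ (⊤ : ℕ∞) ψ → HasCompactSupport ψ → tsupport ψ ⊆ Ω → (∀ x, 0 ≤ ψ x) →
    ∫ x in Ω, f x (u x) (gradient u x) * ψ x ≤
      ∫ x in Ω, ‖gradient u x‖ ^ (p - 2) * ⟪gradient u x, gradient ψ x⟫

def IsWeakSubsolution (p : ℝ) (f : Euc n → ℝ → Euc n → ℝ) (Ω : Set (Euc n))
    (u : Euc n → ℝ) : Prop :=
  IsWeakSupersolution p (fun x s η => -(f x (-s) (-η))) Ω (fun x => -(u x))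

def IsWeakSolution (p : ℝ) (f : Euc n → ℝ → Euc n → ℝ) (Ω : Set (Euc n))
    (u : Euc n → ℝ) : Prop :=
  IsWeakSupersolution p f Ω u ∧ IsWeakSubsolution p f Ω u

/-- `f` is non-increasing in its second argument. -/
def NonincreasingInS (f : Euc n → ℝ → Euc n → ℝ) : Prop :=
  ∀ x η, ∀ s₁ s₂ : ℝ, s₁ ≤ s₂ → f x s₂ η ≤ f x s₁ η

/-- `φ₀ ∈ L^∞_loc(Ω)`. -/
def LocEssBddOn (φ₀ : Euc n → ℝ) (Ω : Set (Euc n)) : Prop :=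
  ∀ x ∈ Ω, ∃ t ∈ 𝓝 x, ∃ C : ℝ, ∀ᵐ y ∂(volume : Measure (Euc n)), y ∈ t → |φ₀ y| ≤ C

/-- `f` is locally Lipschitz continuous with respect to its third variable `η`. -/
def LocLipschitzInEta (f : Euc n → ℝ → Euc n → ℝ) (Ω : Set (Euc n)) : Prop :=
  ∀ x ∈ Ω, ∀ s : ℝ, ∀ η₀ : Euc n, ∃ ε > 0, ∃ K : ℝ,
    ∀ η₁ ∈ ball η₀ ε, ∀ η₂ ∈ ball η₀ ε, |f x s η₁ - f x s η₂| ≤ K * ‖η₁ - η₂‖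

/-- The oscillation `sup_Ω u - inf_Ω u`. -/
def oscOn (u : Euc n → ℝ) (Ω : Set (Euc n)) : ℝ := sSup (u '' Ω) - sInf (u '' Ω)

/-- The infimal convolution `u_ε(x) = inf_{y ∈ Ω} ( u(y) + |x-y|^q / (q ε^{q-1}) )`. -/
def infConv (u : Euc n → ℝ) (Ω : Set (Euc n)) (q ε : ℝ) (x : Euc n) : ℝ :=
  ⨅ y : Ω, (u y + ‖x - (y : Euc n)‖ ^ q / (q * ε ^ (q - 1)))

/-- The radius `r(ε) = ( q ε^{q-1} ( osc_Ω u + 1 ) )^{1/q}`. -/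
def rEps (u : Euc n → ℝ) (Ω : Set (Euc n)) (q ε : ℝ) : ℝ :=
  (q * ε ^ (q - 1) * (oscOn u Ω + 1)) ^ (1 / q)

/-- `f_r(x, s, η) = inf_{y ∈ B_r(x)} f(y, s, η)`. -/
def fEps (f : Euc n → ℝ → Euc n → ℝ) (r : ℝ) (x : Euc n) (s : ℝ) (η : Euc n) : ℝ :=
  ⨅ y : ball x r, f (y : Euc n) s η


lemma continuous_norm_rpow {E : Type*} [NormedAddCommGroup E] {p : ℝ} (hp : 2 < p) :
    Continuous (fun η : E => ‖η‖ ^ (p - 2)) :=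
  continuous_norm.rpow_const fun _ => Or.inr (by linarith)

section Flux

variable {E : Type*} [NormedAddCommGroup E] [InnerProductSpace ℝ E]

/-- The flux `|η|^{p-2} η` of the p-Laplacian. -/
def pFlux (p : ℝ) (η : E) : E := ‖η‖ ^ (p - 2) • η

/-- The derivative of `pFlux p` at `η`. -/
def pFluxDeriv (p : ℝ) (η : E) : E →L[ℝ] E :=
  ‖η‖ ^ (p - 2) • (ContinuousLinearMap.id ℝ E +
    ((p - 2) / ‖η‖ ^ (2 : ℕ)) • (innerSL ℝ η).smulRight η)

lemma norm_pFlux {p : ℝ} (hp : 2 < p) (η : E) : ‖pFlux p η‖ = ‖η‖ ^ (p - 1) := by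
  rw [pFlux, norm_smul, Real.norm_of_nonneg (by positivity)]
  rcases eq_or_ne ‖η‖ 0 with h | h
  · rw [h, mul_zero, Real.zero_rpow (by linarith)]
  · have := Real.rpow_add_one h (p - 2)
    rw [← this]; congr 1; ring

lemma norm_pFluxDeriv_le {p : ℝ} (hp : 2 < p) (η : E) :
    ‖pFluxDeriv p η‖ ≤ ‖η‖ ^ (p - 2) * (1 + (p - 2)) := by
  rw [pFluxDeriv, norm_smul, Real.norm_of_nonneg (by positivity)]
  gcongr
  refine (norm_add_le _ _).trans (add_le_add ContinuousLinearMap.norm_id_le ?_)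
  rw [norm_smul, ContinuousLinearMap.norm_smulRight_apply, innerSL_apply_norm, norm_div, norm_pow,
    norm_norm, Real.norm_of_nonneg (by linarith)]
  rcases eq_or_ne ‖η‖ 0 with h | h
  · simp [h]; linarith
  · exact le_of_eq (by field_simp)

lemma pFluxDeriv_zero {p : ℝ} (hp : 2 < p) : pFluxDeriv p (0 : E) = 0 := by
  simp [pFluxDeriv, Real.zero_rpow (by linarith : p - 2 ≠ 0)]

lemma continuous_pFluxDeriv {p : ℝ} (hp : 2 < p) : Continuous (pFluxDeriv p : E → E →L[ℝ] E) := by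
  rw [continuous_iff_continuousAt]
  intro η
  rcases eq_or_ne η 0 with rfl | h
  · rw [ContinuousAt, pFluxDeriv_zero hp]
    refine squeeze_zero_norm (norm_pFluxDeriv_le hp) ?_
    have := ((continuous_norm_rpow (E := E) hp).mul_const (1 + (p - 2))).tendsto 0
    simpa [Real.zero_rpow (by linarith : p - 2 ≠ 0)] using this
  · unfold pFluxDeriv
    refine (continuous_norm_rpow hp).continuousAt.smul (continuousAt_const.add ?_)
    have hdiv : ContinuousAt (fun η : E => (p - 2) / ‖η‖ ^ 2) η :=
      continuousAt_const.div (by fun_prop) (by simpa using h)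
    refine hdiv.smul ?_
    have : Continuous fun η : E => (innerSL ℝ η).smulRight η :=
      ((ContinuousLinearMap.smulRightL ℝ E E).continuous₂).comp
        ((innerSL ℝ).continuous.prodMk continuous_id)
    exact this.continuousAt

lemma hasFDerivAt_pFlux {p : ℝ} (hp : 2 < p) (η : E) :
    HasFDerivAt (pFlux p) (pFluxDeriv p η) η := by
  rcases eq_or_ne η 0 with rfl | h
  · rw [pFluxDeriv_zero hp]
    refine .of_isLittleO ?_
    have hlim : Tendsto (fun η : E => ‖η‖ ^ (p - 2)) (𝓝 0) (𝓝 0) := by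
      simpa [Real.zero_rpow (by linarith : p - 2 ≠ 0)] using
        (continuous_norm_rpow (E := E) hp).tendsto 0
    have := ((Asymptotics.isLittleO_one_iff ℝ).2 hlim).smul_isBigO
      (Asymptotics.isBigO_refl (fun η : E => η) (𝓝 0))
    simpa [pFlux] using this
  · have h1 : HasFDerivAt (fun x : E => (‖x‖ ^ 2) ^ ((p - 2) / 2)) _ η :=
      (hasStrictFDerivAt_norm_sq η).hasFDerivAt.rpow_const (Or.inl (by simpa using h))
    have h2 : (fun x : E => (‖x‖ ^ 2) ^ ((p - 2) / 2)) = fun x : E => ‖x‖ ^ (p - 2) := by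
      funext x
      rw [← Real.rpow_natCast, ← Real.rpow_mul (norm_nonneg _)]
      congr 1; push_cast; ring
    have hpos : 0 < ‖η‖ := norm_pos_iff.2 h
    have h3 : (‖η‖ ^ 2) ^ ((p - 2) / 2 - 1) = ‖η‖ ^ (p - 2) / ‖η‖ ^ 2 := by
      rw [Real.rpow_sub_one (by positivity), congrFun h2 η]
    rw [h2, h3] at h1
    have h4 := h1.smul (hasFDerivAt_id η)
    refine h4.congr_fderiv ?_
    ext v
    simp only [pFluxDeriv, add_apply, smul_apply,
      ContinuousLinearMap.smulRight_apply, innerSL_apply_apply, id, ContinuousLinearMap.id_apply,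
      smul_add, smul_smul, nsmul_eq_mul, smul_eq_mul]
    congr 2
    push_cast
    ring

lemma contDiff_pFlux {p : ℝ} (hp : 2 < p) : ContDiff ℝ 1 (pFlux p : E → E) := by
  rw [contDiff_one_iff_fderiv]
  refine ⟨fun x => (hasFDerivAt_pFlux hp x).differentiableAt, ?_⟩
  rw [show fderiv ℝ (pFlux p : E → E) = pFluxDeriv p from
    funext fun x => (hasFDerivAt_pFlux hp x).fderiv]
  exact continuous_pFluxDeriv hp

/-- Uniform monotonicity of the flux for `p > 2`. -/
lemma le_inner_pFlux_sub {p : ℝ} (hp : 2 < p) (a b : E) :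
    (‖a - b‖ / 2) ^ (p - 2) * ‖a - b‖ ^ 2 / 2 ≤ ⟪pFlux p a - pFlux p b, a - b⟫ := by
  have hp' : 0 ≤ p - 2 := by linarith
  have key : ⟪pFlux p a - pFlux p b, a - b⟫ =
      (‖a‖ ^ (p - 2) + ‖b‖ ^ (p - 2)) * ‖a - b‖ ^ 2 / 2 +
        (‖a‖ ^ (p - 2) - ‖b‖ ^ (p - 2)) * (‖a‖ ^ 2 - ‖b‖ ^ 2) / 2 := by
    rw [norm_sub_sq_real]
    simp only [pFlux, inner_sub_left, inner_sub_right, real_inner_smul_left,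
      real_inner_self_eq_norm_sq, real_inner_comm a b]
    ring
  have h1 : 0 ≤ (‖a‖ ^ (p - 2) - ‖b‖ ^ (p - 2)) * (‖a‖ ^ 2 - ‖b‖ ^ 2) := by
    rcases le_total ‖a‖ ‖b‖ with h | h
    · exact mul_nonneg_of_nonpos_of_nonpos
        (sub_nonpos.2 (Real.rpow_le_rpow (norm_nonneg _) h hp')) (sub_nonpos.2 (by gcongr))
    · exact mul_nonneg (sub_nonneg.2 (Real.rpow_le_rpow (norm_nonneg _) h hp'))
        (sub_nonneg.2 (by gcongr))
  have h2 : (‖a - b‖ / 2) ^ (p - 2) ≤ ‖a‖ ^ (p - 2) + ‖b‖ ^ (p - 2) := by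
    have := norm_sub_le a b
    rcases le_total ‖a‖ ‖b‖ with h | h
    · have : (‖a - b‖ / 2) ^ (p - 2) ≤ ‖b‖ ^ (p - 2) :=
        Real.rpow_le_rpow (by positivity) (by linarith) hp'
      have : 0 ≤ ‖a‖ ^ (p - 2) := by positivity
      linarith
    · have : (‖a - b‖ / 2) ^ (p - 2) ≤ ‖a‖ ^ (p - 2) :=
        Real.rpow_le_rpow (by positivity) (by linarith) hp'
      have : 0 ≤ ‖b‖ ^ (p - 2) := by positivity
      linarith
  rw [key]
  have := mul_le_mul_of_nonneg_right h2 (sq_nonneg ‖a - b‖)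
  linarith

end Flux

lemma contDiff_gradient {φ : Euc n → ℝ} (hφ : ContDiff ℝ 2 φ) : ContDiff ℝ 1 (gradient φ) :=
  (InnerProductSpace.toDual ℝ (Euc n)).symm.contDiff.comp
    (hφ.fderiv_right (m := 1) (by norm_num))

lemma pLap_eq_trace (p : ℝ) (φ : Euc n → ℝ) (x : Euc n) :
    pLap p φ x = LinearMap.trace ℝ (Euc n)
      ((pFluxDeriv p (gradient φ x)).comp (fderiv ℝ (gradient φ) x)).toLinearMap := by
  set H := fderiv ℝ (gradient φ) x
  set η := gradient φ x
  have h1 : ((pFluxDeriv p η).comp H).toLinearMap =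
      ‖η‖ ^ (p - 2) • (H.toLinearMap + ((p - 2) / ‖η‖ ^ (2 : ℕ)) •
        ((innerSL ℝ η).toLinearMap ∘ₗ H.toLinearMap).smulRight η) := by
    ext v
    simp [pFluxDeriv]
  rw [h1, map_smul, map_add, map_smul, LinearMap.trace_smulRight]
  simp only [LinearMap.comp_apply, ContinuousLinearMap.coe_coe, innerSL_apply_apply, smul_eq_mul,
    pLap, real_inner_comm]
  rfl

lemma continuous_trace : Continuous fun T : Euc n →L[ℝ] Euc n =>
    LinearMap.trace ℝ (Euc n) T.toLinearMap :=
  ((LinearMap.trace ℝ (Euc n)) ∘ₗ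
    (ContinuousLinearMap.coeLM ℝ : (Euc n →L[ℝ] Euc n) →ₗ[ℝ] _)).continuous_of_finiteDimensional

lemma continuous_pLap {p : ℝ} (hp : 2 < p) {φ : Euc n → ℝ} (hφ : ContDiff ℝ 2 φ) :
    Continuous (pLap p φ) := by
  have h := contDiff_gradient hφ
  rw [show pLap p φ = _ from funext (pLap_eq_trace p φ)]
  exact continuous_trace.comp (((continuous_pFluxDeriv hp).comp h.continuous).clm_comp
    (h.continuous_fderiv (by norm_num)))

lemma trace_fderiv_pFlux_gradient {p : ℝ} (hp : 2 < p) {φ : Euc n → ℝ} (hφ : ContDiff ℝ 2 φ)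
    (x : Euc n) :
    LinearMap.trace ℝ (Euc n) (fderiv ℝ (fun y => pFlux p (gradient φ y)) x).toLinearMap =
      pLap p φ x := by
  rw [pLap_eq_trace]
  congr 2
  exact ((hasFDerivAt_pFlux hp _).comp x
    ((contDiff_gradient hφ).differentiable (by norm_num) x).hasFDerivAt).fderiv

/-- Integration by parts for a compactly supported `C¹` vector field. -/
lemma integral_trace_fderiv_mul {V : Euc n → Euc n} (hV : ContDiff ℝ 1 V)
    (hVc : HasCompactSupport V) {ψ : Euc n → ℝ} (hψ : ContDiff ℝ (⊤ : ℕ∞) ψ)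
    (hψc : HasCompactSupport ψ) :
    ∫ x, LinearMap.trace ℝ (Euc n) (fderiv ℝ V x).toLinearMap * ψ x =
      -∫ x, ⟪V x, gradient ψ x⟫ := by
  obtain ⟨D, hD⟩ := ContDiff.lipschitzWith_of_hasCompactSupport hψc hψ (by simp)
  set b := EuclideanSpace.basisFun (Fin n) ℝ
  have hψ1 : ContDiff ℝ 1 ψ := hψ.of_le (by exact_mod_cast le_top)
  have hcomp (i : Fin n) :
      ∫ x, ⟪b i, fderiv ℝ V x (b i)⟫ * ψ x = ∫ x, -(⟪V x, b i⟫ * ⟪b i, gradient ψ x⟫) := by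
    have hVi : ContDiff ℝ 1 fun x => ⟪b i, V x⟫ := contDiff_const.inner ℝ hV
    obtain ⟨C, hC⟩ := ContDiff.lipschitzWith_of_hasCompactSupport
      (hVc.comp_left (g := fun y => ⟪b i, y⟫) (by simp)) hVi (by simp)
    have := hC.integral_lineDeriv_mul_eq hD hψc (b i) (μ := volume)
    convert this using 3 with x x
    · congr 1
      have h1 : HasFDerivAt (fun x => ⟪b i, V x⟫) _ x :=
        (innerSL ℝ (b i)).hasFDerivAt.comp x (hV.differentiable (by norm_num) x).hasFDerivAt
      have h2 := h1.hasLineDerivAt (b i)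
      exact h2.lineDeriv.symm
    · rw [((hψ1.differentiable (by norm_num)) x).lineDeriv_eq_fderiv, map_neg,
        ← inner_gradient_left, Function.comp_apply, real_inner_comm (b i), real_inner_comm (b i)]
      ring
  have hgψ : Continuous (gradient ψ) :=
    (InnerProductSpace.toDual ℝ (Euc n)).symm.continuous.comp
      (hψ1.continuous_fderiv (by norm_num))
  have hfV := hV.continuous_fderiv (by norm_num)
  have hVcont := hV.continuous
  have hint1 (i : Fin n) : Integrable (fun x => ⟪b i, fderiv ℝ V x (b i)⟫ * ψ x) := by
    refine Continuous.integrable_of_hasCompactSupport ?_ hψc.mul_left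
    have := hψ.continuous
    fun_prop
  have hint2 (i : Fin n) : Integrable (fun x => -(⟪V x, b i⟫ * ⟪b i, gradient ψ x⟫)) := by
    refine Continuous.integrable_of_hasCompactSupport (by fun_prop) ?_
    refine hVc.mono fun x hx hx' => hx ?_
    simp [show V x = 0 from hx']
  calc _ = ∫ x, ∑ i, ⟪b i, fderiv ℝ V x (b i)⟫ * ψ x := by
        refine integral_congr_ae (.of_forall fun x => ?_)
        simp only [LinearMap.trace_eq_sum_inner _ b, Finset.sum_mul, ContinuousLinearMap.coe_coe]
    _ = ∑ i, ∫ x, -(⟪V x, b i⟫ * ⟪b i, gradient ψ x⟫) := by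
        rw [integral_finsetSum _ fun i _ => hint1 i]
        exact Finset.sum_congr rfl fun i _ => hcomp i
    _ = _ := by
        rw [← integral_finsetSum _ fun i _ => hint2 i, ← integral_neg]
        refine integral_congr_ae (.of_forall fun x => ?_)
        simp only [Finset.sum_neg_distrib, b.sum_inner_mul_inner]

open scoped Convolution in
/-- The convolution of a bump function with a Lipschitz function is differentiated under the
integral sign. -/
lemma hasFDerivAt_normed_convolution {K : ℝ≥0} {w : Euc n → ℝ} (hw : LipschitzWith K w)
    (ρ : ContDiffBump (0 : Euc n)) (x : Euc n) :
    HasFDerivAt (ρ.normed volume ⋆[ContinuousLinearMap.lsmul ℝ ℝ, volume] w)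
      ((ρ.normed volume ⋆[ContinuousLinearMap.lsmul ℝ ℝ, volume] (fderiv ℝ w)) x) x := by
  have hρc : Continuous (ρ.normed volume) := ρ.continuous_normed
  have hwc := hw.continuous
  have hmeas : Measurable (fderiv ℝ w) := measurable_fderiv ℝ w
  refine (hasFDerivAt_integral_of_dominated_loc_of_lip (𝕜 := ℝ)
    (F := fun x t => ρ.normed volume t • w (x - t))
    (F' := fun t => ρ.normed volume t • fderiv ℝ w (x - t))
    (bound := fun t => ρ.normed volume t * K) univ_mem ?_ ?_ ?_ ?_ ?_ ?_).2
  · exact .of_forall fun y => (by fun_prop : Continuous _).aestronglyMeasurable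
  · refine Continuous.integrable_of_hasCompactSupport (by fun_prop) ?_
    exact ρ.hasCompactSupport_normed.smul_right
  · refine hρc.aestronglyMeasurable.smul ?_
    exact (hmeas.comp (by fun_prop)).aestronglyMeasurable
  · refine .of_forall fun t => LipschitzWith.lipschitzOnWith ?_
    refine LipschitzWith.of_dist_le_mul fun y z => ?_
    have h1 := hw.dist_le_mul (y - t) (z - t)
    rw [dist_sub_right] at h1
    have h0 := ρ.nonneg_normed (μ := volume) t
    rw [dist_smul₀, Real.coe_nnabs, Real.norm_of_nonneg h0, abs_of_nonneg (by positivity),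
      mul_assoc]
    gcongr
  · exact ρ.integrable_normed.mul_const _
  · have := (quasiMeasurePreserving_sub_left_of_right_invariant volume x).ae
      hw.ae_differentiableAt
    filter_upwards [this] with t ht
    have h2 : HasFDerivAt (fun y : Euc n => w (y - t)) (fderiv ℝ w (x - t)) x := by
      have h3 := ht.hasFDerivAt.comp x ((hasFDerivAt_id x).sub_const t)
      rwa [ContinuousLinearMap.comp_id] at h3
    exact h2.fun_const_smul _

lemma norm_gradient (w : Euc n → ℝ) (x : Euc n) : ‖gradient w x‖ = ‖fderiv ℝ w x‖ := by
  simp [gradient]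

lemma LipschitzWith.norm_gradient_le {K : ℝ≥0} {w : Euc n → ℝ} (hw : LipschitzWith K w)
    (x : Euc n) : ‖gradient w x‖ ≤ K :=
  norm_gradient w x ▸ norm_fderiv_le_of_lipschitz ℝ hw

lemma measurable_gradient (w : Euc n → ℝ) : Measurable (gradient w) :=
  (InnerProductSpace.toDual ℝ (Euc n)).symm.continuous.measurable.comp (measurable_fderiv ℝ w)

lemma gradient_eq_zero_of_notMem_tsupport {w : Euc n → ℝ} {x : Euc n} (hx : x ∉ tsupport w) :
    gradient w x = 0 := by
  rw [← norm_eq_zero, norm_gradient, norm_eq_zero]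
  exact Function.notMem_support.1 fun h => hx (support_fderiv_subset ℝ h)

open scoped Convolution in
/-- A Lipschitz compactly supported nonnegative function is a limit of smooth ones, with locally
uniformly bounded and almost everywhere convergent gradients. -/
lemma exists_smooth_approx {K : ℝ≥0} {w : Euc n → ℝ} (hw : LipschitzWith K w)
    (hwc : HasCompactSupport w) (hw0 : ∀ x, 0 ≤ w x) {U : Set (Euc n)} (hU : IsOpen U)
    (hwU : tsupport w ⊆ U) :
    ∃ k : Set (Euc n), IsCompact k ∧ k ⊆ U ∧ tsupport w ⊆ k ∧ ∃ ψ : ℕ → Euc n → ℝ,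
      (∀ j, ContDiff ℝ (⊤ : ℕ∞) (ψ j)) ∧ (∀ j, tsupport (ψ j) ⊆ k) ∧ (∀ j x, 0 ≤ ψ j x) ∧
      (∀ j, LipschitzWith K (ψ j)) ∧ (∀ j x, |ψ j x - w x| ≤ K) ∧
      (∀ x, Tendsto (fun j => ψ j x) atTop (𝓝 (w x))) ∧
      ∀ᵐ x, Tendsto (fun j => gradient (ψ j) x) atTop (𝓝 (gradient w x)) := by
  obtain ⟨δ, hδ, hδU⟩ := hwc.isCompact.exists_cthickening_subset_open hU hwU
  set r : ℕ → ℝ := fun j => min δ 1 / (j + 1) with hr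
  have hmin : 0 < min δ 1 := lt_min hδ one_pos
  have hrpos (j) : 0 < r j := by positivity
  have hrle (j) : r j ≤ min δ 1 :=
    div_le_self hmin.le (by linarith [(Nat.cast_nonneg j : (0 : ℝ) ≤ j)])
  have hr0 : Tendsto r atTop (𝓝 0) := by
    have := (tendsto_one_div_add_atTop_nhds_zero_nat (𝕜 := ℝ)).const_mul (min δ 1)
    simpa [hr, div_eq_mul_inv] using this
  let ρ : ℕ → ContDiffBump (0 : Euc n) := fun j =>
    ⟨r j / 2, r j, by have := hrpos j; positivity, by have := hrpos j; linarith⟩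
  set ψ : ℕ → Euc n → ℝ := fun j =>
    (ρ j).normed volume ⋆[ContinuousLinearMap.lsmul ℝ ℝ, volume] w with hψ
  have hwcont := hw.continuous
  have hfd (j x) := hasFDerivAt_normed_convolution hw (ρ j) x
  refine ⟨cthickening δ (tsupport w), hwc.isCompact.cthickening, hδU,
    self_subset_cthickening _, ψ, fun j => ?_, fun j => ?_, fun j x => ?_, fun j => ?_,
    fun j x => ?_, fun x => ?_, ?_⟩
  · exact (ρ j).hasCompactSupport_normed.contDiff_convolution_left _ (ρ j).contDiff_normed
      hwcont.locallyIntegrable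
  · refine closure_minimal ?_ isClosed_cthickening
    refine (support_convolution_subset_swap _).trans ?_
    rintro _ ⟨a, ha, b, hb, rfl⟩
    refine mem_cthickening_of_dist_le _ a δ _ (subset_tsupport _ ha) ?_
    rw [(ρ j).support_normed_eq, mem_ball_zero_iff] at hb
    have : ‖b‖ < r j := hb
    have h2 : ‖b‖ ≤ δ := this.le.trans ((hrle j).trans (min_le_left _ _))
    simpa [dist_eq_norm] using h2
  · exact integral_nonneg fun t => mul_nonneg ((ρ j).nonneg_normed t) (hw0 _)
  · refine LipschitzWith.of_dist_le_mul fun y z => ?_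
    have hint (y : Euc n) : Integrable fun t => (ρ j).normed volume t • w (y - t) := by
      refine Continuous.integrable_of_hasCompactSupport ?_
        (ρ j).hasCompactSupport_normed.smul_right
      have := (ρ j).continuous_normed (μ := volume)
      fun_prop
    have h1 : ψ j y - ψ j z = ∫ t, (ρ j).normed volume t • (w (y - t) - w (z - t)) := by
      simp only [hψ, convolution_lsmul, smul_sub]
      rw [integral_sub (hint y) (hint z)]
    rw [dist_eq_norm, h1]
    calc _ ≤ ∫ t, (ρ j).normed volume t * (K * dist y z) := by
          refine norm_integral_le_of_norm_le ((ρ j).integrable_normed.mul_const _)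
            (.of_forall fun t => ?_)
          have h0 := (ρ j).nonneg_normed (μ := volume) t
          have h1 := hw.dist_le_mul (y - t) (z - t)
          rw [dist_sub_right, dist_eq_norm] at h1
          rw [norm_smul, Real.norm_of_nonneg h0]
          gcongr
      _ = _ := by rw [integral_mul_const, (ρ j).integral_normed, one_mul]
  · rw [← Real.dist_eq]
    refine (ρ j).dist_normed_convolution_le hwcont.aestronglyMeasurable fun y hy => ?_
    refine (hw.dist_le_mul y x).trans (mul_le_of_le_one_right K.2 ?_)
    have : dist y x < r j := hy
    exact this.le.trans ((hrle j).trans (min_le_right _ _))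
  · exact ContDiffBump.convolution_tendsto_right_of_continuous (φ := ρ) hr0 hwcont x
  · have hloc : LocallyIntegrable (fderiv ℝ w) volume := by
      refine (memLp_top_of_bound (measurable_fderiv ℝ w).aestronglyMeasurable K
        (.of_forall fun x => norm_fderiv_le_of_lipschitz ℝ hw)).locallyIntegrable le_top
    have := ContDiffBump.ae_convolution_tendsto_right_of_locallyIntegrable (φ := ρ) (l := atTop)
      (K := 2) hr0 (.of_forall fun j => by simp only [ρ]; linarith) hloc
    filter_upwards [this] with x hx
    have h2 := ((InnerProductSpace.toDual ℝ (Euc n)).symm.continuous.tendsto _).comp hx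
    refine h2.congr fun j => ?_
    simp only [gradient, Function.comp_apply, hψ, (hfd j x).fderiv]

/-- A distributional inequality with bounded coefficients tested with smooth functions extends to
Lipschitz test functions. -/
lemma integral_le_integral_inner_of_lipschitz {G : Euc n → Euc n} {g : Euc n → ℝ}
    (hG : AEStronglyMeasurable G) (hg : AEStronglyMeasurable g) {M : ℝ} (hGM : ∀ x, ‖G x‖ ≤ M)
    (hgM : ∀ x, |g x| ≤ M) {U : Set (Euc n)} (hU : IsOpen U)
    (h : ∀ ψ : Euc n → ℝ, ContDiff ℝ (⊤ : ℕ∞) ψ → HasCompactSupport ψ → tsupport ψ ⊆ U →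
      (∀ x, 0 ≤ ψ x) → ∫ x, g x * ψ x ≤ ∫ x, ⟪G x, gradient ψ x⟫)
    {K : ℝ≥0} {w : Euc n → ℝ} (hw : LipschitzWith K w) (hwc : HasCompactSupport w)
    (hw0 : ∀ x, 0 ≤ w x) (hwU : tsupport w ⊆ U) :
    ∫ x, g x * w x ≤ ∫ x, ⟪G x, gradient w x⟫ := by
  obtain ⟨k, hk, hkU, hwk, ψ, hψs, hψk, hψ0, hψK, hψw, hψlim, hψlim'⟩ :=
    exists_smooth_approx hw hwc hw0 hU hwU
  have hM : 0 ≤ M := (norm_nonneg _).trans (hGM 0)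
  obtain ⟨C, hC⟩ := hwc.exists_bound_of_continuous hw.continuous
  have hbdd (c : ℝ) : Integrable (k.indicator fun _ : Euc n => c) :=
    (integrableOn_const hk.measure_lt_top.ne).integrable_indicator hk.measurableSet
  have h1 : Tendsto (fun j => ∫ x, g x * ψ j x) atTop (𝓝 (∫ x, g x * w x)) := by
    refine tendsto_integral_of_dominated_convergence (k.indicator fun _ => M * (C + K))
      (fun j => hg.mul (hψK j).continuous.aestronglyMeasurable) (hbdd _)
      (fun j => .of_forall fun x => ?_) (.of_forall fun x => (hψlim x).const_mul _)
    by_cases hx : x ∈ k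
    · rw [indicator_of_mem hx, norm_mul]
      have := hψw j x
      have h2 := hC x
      have h3 : ‖ψ j x‖ ≤ C + K := by
        have := norm_add_le (w x) (ψ j x - w x)
        rw [add_sub_cancel, Real.norm_eq_abs (ψ j x - w x)] at this
        linarith
      exact mul_le_mul (hgM x) h3 (norm_nonneg _) hM
    · rw [indicator_of_notMem hx, image_eq_zero_of_notMem_tsupport fun h => hx (hψk j h)]
      simp
  have h2 : Tendsto (fun j => ∫ x, ⟪G x, gradient (ψ j) x⟫) atTop
      (𝓝 (∫ x, ⟪G x, gradient w x⟫)) := by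
    refine tendsto_integral_of_dominated_convergence (k.indicator fun _ => M * K)
      (fun j => hG.inner (measurable_gradient _).aestronglyMeasurable) (hbdd _)
      (fun j => .of_forall fun x => ?_) (hψlim'.mono fun x hx => tendsto_const_nhds.inner hx)
    by_cases hx : x ∈ k
    · rw [indicator_of_mem hx]
      exact (norm_inner_le_norm _ _).trans
        (mul_le_mul (hGM x) ((hψK j).norm_gradient_le x) (norm_nonneg _) hM)
    · rw [indicator_of_notMem hx,
        gradient_eq_zero_of_notMem_tsupport fun h => hx (hψk j h)]
      simp
  exact le_of_tendsto_of_tendsto' h1 h2 fun j => h (ψ j) (hψs j)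
    (hk.of_isClosed_subset (isClosed_tsupport _) (hψk j)) ((hψk j).trans hkU) (hψ0 j)

lemma integrable_inner_gradient {G : Euc n → Euc n} (hG : AEStronglyMeasurable G) {M : ℝ}
    (hGM : ∀ x, ‖G x‖ ≤ M) {K : ℝ≥0} {w : Euc n → ℝ} (hw : LipschitzWith K w)
    (hwc : HasCompactSupport w) : Integrable fun x => ⟪G x, gradient w x⟫ := by
  refine Integrable.mono' (g := (tsupport w).indicator fun _ => M * K)
    ((integrableOn_const hwc.isCompact.measure_lt_top.ne).integrable_indicator
      hwc.isCompact.measurableSet)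
    (hG.inner (measurable_gradient _).aestronglyMeasurable) (.of_forall fun x => ?_)
  by_cases hx : x ∈ tsupport w
  · rw [indicator_of_mem hx]
    exact (norm_inner_le_norm _ _).trans (mul_le_mul (hGM x) (hw.norm_gradient_le x)
      (norm_nonneg _) ((norm_nonneg _).trans (hGM x)))
  · simp [indicator_of_notMem hx, gradient_eq_zero_of_notMem_tsupport hx]

lemma integrable_mul_of_bounded {g : Euc n → ℝ} (hg : AEStronglyMeasurable g) {M : ℝ}
    (hgM : ∀ x, |g x| ≤ M) {w : Euc n → ℝ} (hw : Continuous w) (hwc : HasCompactSupport w) :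
    Integrable fun x => g x * w x :=
  (hw.integrable_of_hasCompactSupport hwc).bdd_mul hg (.of_forall hgM)

lemma Filter.EventuallyEq.pLap_eq (p : ℝ) {φ₁ φ₂ : Euc n → ℝ} {x : Euc n} (h : φ₁ =ᶠ[𝓝 x] φ₂) :
    pLap p φ₁ x = pLap p φ₂ x := by
  simp only [pLap, h.gradient.fderiv_eq, h.gradient_eq]

lemma exists_contDiff_hasCompactSupport_eventuallyEq {Ω : Set (Euc n)} (hΩ : IsOpen Ω)
    {φ : Euc n → ℝ} (hφ : ContDiffOn ℝ 2 φ Ω) {x₀ : Euc n} (hx₀ : x₀ ∈ Ω) :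
    ∃ φ₁ : Euc n → ℝ, ContDiff ℝ 2 φ₁ ∧ HasCompactSupport φ₁ ∧ φ₁ =ᶠ[𝓝 x₀] φ := by
  obtain ⟨R, hR, hRΩ⟩ := nhds_basis_closedBall.mem_iff.1 (hΩ.mem_nhds hx₀)
  let χ : ContDiffBump x₀ := ⟨R / 2, R, by linarith, by linarith⟩
  refine ⟨fun x => χ x * φ x, ?_, χ.hasCompactSupport.mul_right, ?_⟩
  · refine contDiff_iff_contDiffAt.2 fun x => ?_
    by_cases hx : x ∉ tsupport fun x => χ x * φ x
    · exact contDiffAt_const.congr_of_eventuallyEq (notMem_tsupport_iff_eventuallyEq.1 hx)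
    rw [not_not] at hx
    have hx' : x ∈ Ω := hRΩ (χ.tsupport_eq ▸ tsupport_mul_subset_left hx)
    exact χ.contDiff.contDiffAt.mul (hφ.contDiffAt (hΩ.mem_nhds hx'))
  · filter_upwards [χ.eventuallyEq_one] with x hx
    simp [hx]

lemma contDiff_norm_sub_pow_four (x₀ : Euc n) : ContDiff ℝ 2 fun x : Euc n => ‖x - x₀‖ ^ 4 := by
  have : ContDiff ℝ 2 fun x : Euc n => (‖x - x₀‖ ^ 2) ^ 2 :=
    ((contDiff_norm_sq ℝ).comp (contDiff_id.sub contDiff_const)).pow 2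
  simpa [← pow_mul] using this

lemma gradient_sub_norm_sub_pow_four {φ : Euc n → ℝ} (hφ : ContDiff ℝ 2 φ) (x₀ x : Euc n) :
    gradient (fun y => φ y - ‖y - x₀‖ ^ 4) x = gradient φ x - (4 : ℝ) • pFlux 4 (x - x₀) := by
  have h1 : HasFDerivAt (fun y : Euc n => ‖y - x₀‖ ^ (4 : ℝ)) _ x :=
    HasFDerivAt.comp (g := fun y : Euc n => ‖y‖ ^ (4 : ℝ)) (f := fun y => y - x₀) x
      (hasFDerivAt_norm_rpow (x - x₀) (by norm_num)) ((hasFDerivAt_id x).sub_const x₀)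
  have h2 := ((hφ.differentiable (by norm_num) x).hasFDerivAt.sub h1).fderiv
  have h3 : (fun y => φ y - ‖y - x₀‖ ^ 4) = φ - fun y : Euc n => ‖y - x₀‖ ^ (4 : ℝ) := by
    funext y
    have := Real.rpow_natCast ‖y - x₀‖ 4
    simp only [Pi.sub_apply]
    rw [← this]
    norm_num
  refine ext_inner_right ℝ fun v => ?_
  rw [inner_gradient_left, inner_sub_left, inner_gradient_left, h3, h2]
  simp [pFlux, inner_sub_left, real_inner_smul_left, mul_assoc]

lemma gradient_sub_norm_sub_pow_four_self {φ : Euc n → ℝ} (hφ : ContDiff ℝ 2 φ) (x₀ : Euc n) :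
    gradient (fun y => φ y - ‖y - x₀‖ ^ 4) x₀ = gradient φ x₀ := by
  rw [gradient_sub_norm_sub_pow_four hφ]
  simp [pFlux]

lemma pLap_sub_norm_sub_pow_four_self (p : ℝ) {φ : Euc n → ℝ} (hφ : ContDiff ℝ 2 φ)
    (x₀ : Euc n) : pLap p (fun y => φ y - ‖y - x₀‖ ^ 4) x₀ = pLap p φ x₀ := by
  have h1 : HasFDerivAt (fun x => gradient φ x - (4 : ℝ) • pFlux 4 (x - x₀))
      (fderiv ℝ (gradient φ) x₀) x₀ := by
    have h2 : HasFDerivAt (fun x : Euc n => pFlux 4 (x - x₀)) _ x₀ :=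
      HasFDerivAt.comp (g := pFlux 4) (f := fun y => y - x₀) x₀
        (hasFDerivAt_pFlux (by norm_num) (x₀ - x₀)) ((hasFDerivAt_id x₀).sub_const x₀)
    have h3 := (((contDiff_gradient hφ).differentiable (by norm_num) x₀).hasFDerivAt).sub
      (h2.const_smul (4 : ℝ))
    rw [sub_self, pFluxDeriv_zero (by norm_num)] at h3
    exact h3.congr_fderiv (by simp)
  rw [← funext (gradient_sub_norm_sub_pow_four hφ x₀)] at h1
  simp only [pLap, gradient_sub_norm_sub_pow_four_self hφ, h1.fderiv]

lemma le_limsupPunct [Nontrivial (Euc n)] {g : Euc n → ℝ} {x₀ : Euc n} (hg : ContinuousAt g x₀) :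
    (g x₀ : EReal) ≤ limsupPunct g x₀ := by
  refine le_iInf₂ fun r hr => ?_
  have h1 : Tendsto (fun x => (g x : EReal)) (𝓝[≠] x₀) (𝓝 (g x₀)) :=
    (continuous_coe_real_ereal.continuousAt.comp hg).mono_left nhdsWithin_le_nhds
  refine le_of_tendsto h1 ?_
  filter_upwards [self_mem_nhdsWithin, nhdsWithin_le_nhds (ball_mem_nhds x₀ hr)] with x hx hxr
  exact le_iSup₂ (f := fun x (_ : x ∈ ball x₀ r \ {x₀}) => (g x : EReal)) x ⟨hxr, hx⟩

/-- The truncated difference of a perturbed test function and the solution. -/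
lemma exists_lipschitz_bump {Φ u : Euc n → ℝ} {C K : ℝ≥0} (hΦ : LipschitzWith C Φ)
    (hu : LipschitzWith K u) {x₀ : Euc n} {R s : ℝ} (hs : 0 < s) (hs1 : s ≤ 1) (hsR : 3 * s ≤ R)
    (hx₀ : Φ x₀ = u x₀) (hle : ∀ x ∈ ball x₀ R, Φ x ≤ u x - ‖x - x₀‖ ^ 4) :
    ∃ (L : ℝ≥0) (w : Euc n → ℝ), LipschitzWith L w ∧ tsupport w ⊆ closedBall x₀ s ∧
      (∀ x, 0 ≤ w x) ∧ (∀ x, w x ≤ s ^ 4) ∧ 0 < w x₀ ∧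
      ∀ x, 0 < w x → w =ᶠ[𝓝 x] fun y => Φ y + s ^ 4 - u y := by
  have hs4 : s ^ 4 ≤ s := by simpa using pow_le_pow_of_le_one hs.le hs1 (show 1 ≤ 4 by norm_num)
  have hs4' : 0 < s ^ 4 := by positivity
  set v : Euc n → ℝ := fun y => Φ y + s ^ 4 - u y with hv
  set w : Euc n → ℝ := fun y => max (min (v y) (R - dist y x₀)) 0 with hw
  have hvL : LipschitzWith (C + 0 + K) v := (hΦ.add (LipschitzWith.const (s ^ 4))).sub hu
  have hdL : LipschitzWith (0 + 1) fun y : Euc n => R - dist y x₀ :=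
    (LipschitzWith.const R).sub (LipschitzWith.dist_left x₀)
  have hvle (x) (hx : x ∈ ball x₀ R) : v x ≤ s ^ 4 - dist x x₀ ^ 4 := by
    have := hle x hx
    rw [dist_eq_norm]
    simp only [hv]; linarith
  have hpos (x) (hx : 0 < w x) : x ∈ ball x₀ s ∧ 0 < v x := by
    have h1 : 0 < min (v x) (R - dist x x₀) := by simpa [hw] using hx
    obtain ⟨h2, h3⟩ := lt_min_iff.1 h1
    have h4 := hvle x (mem_ball.2 (by linarith))
    refine ⟨mem_ball.2 (lt_of_pow_lt_pow_left₀ 4 hs.le (by linarith)), h2⟩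
  have heq (x) (hx : x ∈ ball x₀ s) (hvx : 0 < v x) : w x = v x := by
    rw [mem_ball] at hx
    have h1 := hvle x (mem_ball.2 (by linarith))
    have h2 : 0 ≤ dist x x₀ ^ 4 := by positivity
    simp only [hw]
    rw [min_eq_left (by linarith), max_eq_left hvx.le]
  have hw0 (x) : 0 ≤ w x := le_max_right _ _
  refine ⟨max (max (C + 0 + K) (0 + 1)) 0, w, (hvL.min hdL).max (LipschitzWith.const 0),
    ?_, hw0, fun x => ?_, ?_, fun x hx => ?_⟩
  · refine closure_minimal (fun x hx => ?_) isClosed_closedBall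
    exact ball_subset_closedBall (hpos x (lt_of_le_of_ne (hw0 x) (Ne.symm hx))).1
  · rcases (hw0 x).eq_or_lt with h | h
    · rw [← h]; exact hs4'.le
    · obtain ⟨h1, h2⟩ := hpos x h
      rw [heq x h1 h2]
      have := hvle x (ball_subset_ball (by linarith) h1)
      have h2 : 0 ≤ dist x x₀ ^ 4 := by positivity
      linarith
  · have h1 : v x₀ = s ^ 4 := by simp [hv, hx₀]
    rw [heq x₀ (mem_ball_self hs) (by rwa [h1]), h1]
    exact hs4'
  · obtain ⟨h1, h2⟩ := hpos x hx
    filter_upwards [isOpen_ball.mem_nhds h1,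
      hvL.continuous.continuousAt.eventually (lt_mem_nhds h2)] with y hy hy'
    exact heq y hy hy'

lemma norm_pFlux_gradient_le {p : ℝ} (hp : 2 < p) {K : ℝ≥0} {v : Euc n → ℝ}
    (hv : LipschitzWith K v) (x : Euc n) : ‖pFlux p (gradient v x)‖ ≤ (K : ℝ) ^ (p - 1) := by
  rw [norm_pFlux hp]
  exact Real.rpow_le_rpow (norm_nonneg _) (hv.norm_gradient_le x) (by linarith)

lemma measurable_pFlux_gradient {p : ℝ} (hp : 2 < p) (v : Euc n → ℝ) :
    Measurable fun x => pFlux p (gradient v x) :=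
  (contDiff_pFlux hp).continuous.measurable.comp (measurable_gradient v)

/-- The weak inequality for `u` minus the divergence identity for a smooth function `Φ`. -/
lemma IsWeakSupersolution.integral_le_integral_inner_sub {p : ℝ} (hp : 2 < p)
    {f : Euc n → ℝ → Euc n → ℝ} {Ω B : Set (Euc n)} (hBΩ : B ⊆ Ω) {u v Φ : Euc n → ℝ}
    (hweak : IsWeakSupersolution p f Ω u) {K : ℝ≥0} (hv : LipschitzWith K v)
    (huv : ∀ x ∈ B, gradient u x = gradient v x) (hΦ : ContDiff ℝ 2 Φ)
    (hΦc : HasCompactSupport Φ) {g : Euc n → ℝ} (hg : AEStronglyMeasurable g) {M : ℝ}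
    (hgM : ∀ x, |g x| ≤ M) (hgB : ∀ x ∈ B, g x = f x (u x) (gradient v x) + pLap p Φ x)
    {ψ : Euc n → ℝ} (hψ : ContDiff ℝ (⊤ : ℕ∞) ψ) (hψc : HasCompactSupport ψ)
    (hψB : tsupport ψ ⊆ B) (hψ0 : ∀ x, 0 ≤ ψ x) :
    ∫ x, g x * ψ x ≤ ∫ x, ⟪pFlux p (gradient v x) - pFlux p (gradient Φ x), gradient ψ x⟫ := by
  have hψz (x) (hx : x ∉ B) : ψ x = 0 := image_eq_zero_of_notMem_tsupport fun h => hx (hψB h)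
  have hψgz (x) (hx : x ∉ B) : gradient ψ x = 0 :=
    gradient_eq_zero_of_notMem_tsupport fun h => hx (hψB h)
  obtain ⟨D, hD⟩ := ContDiff.lipschitzWith_of_hasCompactSupport hψc hψ (by simp)
  obtain ⟨C, hC⟩ := ContDiff.lipschitzWith_of_hasCompactSupport hΦc hΦ (by norm_num)
  have hV : ContDiff ℝ 1 fun x => pFlux p (gradient Φ x) :=
    (contDiff_pFlux hp).comp (contDiff_gradient hΦ)
  have hVc : HasCompactSupport fun x => pFlux p (gradient Φ x) := by
    refine HasCompactSupport.intro hΦc.isCompact fun x hx => ?_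
    simp [gradient_eq_zero_of_notMem_tsupport hx, pFlux]
  have hdiv := integral_trace_fderiv_mul hV hVc hψ hψc
  simp only [trace_fderiv_pFlux_gradient hp hΦ] at hdiv
  have hint1 : Integrable fun x => pLap p Φ x * ψ x :=
    ((continuous_pLap hp hΦ).mul hψ.continuous).integrable_of_hasCompactSupport hψc.mul_left
  have hint2 : Integrable fun x => g x * ψ x :=
    integrable_mul_of_bounded hg hgM hψ.continuous hψc
  have hint3 : Integrable fun x => ⟪pFlux p (gradient v x), gradient ψ x⟫ :=
    integrable_inner_gradient (measurable_pFlux_gradient hp v).aestronglyMeasurable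
      (norm_pFlux_gradient_le hp hv) hD hψc
  have hint4 : Integrable fun x => ⟪pFlux p (gradient Φ x), gradient ψ x⟫ :=
    integrable_inner_gradient (measurable_pFlux_gradient hp Φ).aestronglyMeasurable
      (norm_pFlux_gradient_le hp hC) hD hψc
  have hw := hweak ψ hψ hψc (hψB.trans hBΩ) hψ0
  rw [setIntegral_eq_integral_of_forall_compl_eq_zero fun x hx => by
      rw [hψz x fun h => hx (hBΩ h), mul_zero],
    setIntegral_eq_integral_of_forall_compl_eq_zero fun x hx => by
      rw [hψgz x fun h => hx (hBΩ h), inner_zero_right, mul_zero]] at hw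
  have e1 : ∫ x, f x (u x) (gradient u x) * ψ x = ∫ x, (g x * ψ x - pLap p Φ x * ψ x) := by
    refine integral_congr_ae (.of_forall fun x => ?_)
    by_cases hx : x ∈ B
    · simp only [hgB x hx, huv x hx]; ring
    · simp [hψz x hx]
  have e2 : ∫ x, ‖gradient u x‖ ^ (p - 2) * ⟪gradient u x, gradient ψ x⟫ =
      ∫ x, ⟪pFlux p (gradient v x), gradient ψ x⟫ := by
    refine integral_congr_ae (.of_forall fun x => ?_)
    by_cases hx : x ∈ B
    · simp only [huv x hx, pFlux, real_inner_smul_left]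
    · simp [hψgz x hx]
  rw [e1, e2, integral_sub hint2 hint1, hdiv] at hw
  simp only [inner_sub_left]
  rw [integral_sub hint3 hint4]
  linarith

/-- **Theorem (paper Thm 1.4 (iii)).** For `p > 2`, locally Lipschitz weak supersolutions of
`-Δ_p u = f(x, u, ∇u)` with nonvanishing gradient are viscosity supersolutions, for `f`
continuous, non-increasing in `s`, and locally Lipschitz in `η`. -/
theorem weak_implies_viscosity_supersolution_degenerate_nonvanishing
    (n : ℕ) (Ω : Set (Euc n)) (hΩo : IsOpen Ω) (hΩb : Bornology.IsBounded Ω)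
    (p : ℝ) (hp : 2 < p)
    (f : Euc n → ℝ → Euc n → ℝ)
    (hfc : ContinuousOn (fun w : Euc n × ℝ × Euc n => f w.1 w.2.1 w.2.2)
      (Ω ×ˢ (univ : Set ℝ) ×ˢ (univ : Set (Euc n))))
    (hfmono : NonincreasingInS f)
    (hfLip : LocLipschitzInEta f Ω)
    (u : Euc n → ℝ) (huLip : LocallyLipschitzOn Ω u)
    (hweak : IsWeakSupersolution p f Ω u)
    (hgrad : ∀ x ∈ Ω, DifferentiableAt ℝ u x → gradient u x ≠ 0) :
    IsViscositySupersolution p f Ω u := by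
  intro x₀ hx₀ φ hφ hφx₀ hφu _
  rcases subsingleton_or_nontrivial (Euc n) with hsub | hnt
  · exact absurd (Subsingleton.elim _ _)
      (hgrad x₀ hx₀ (hasFDerivAt_of_subsingleton u x₀).differentiableAt)
  obtain ⟨φ₁, hφ₁, -, hφ₁φ⟩ := exists_contDiff_hasCompactSupport_eventuallyEq hΩo hφ hx₀
  have hpLapφ : ContinuousAt (fun x => -pLap p φ x) x₀ :=
    (continuous_pLap hp hφ₁).neg.continuousAt.congr
      (hφ₁φ.eventuallyEq_nhds.mono fun x hx => by simp [hx.pLap_eq p])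
  refine le_trans (EReal.coe_le_coe_iff.2 ?_) (le_limsupPunct hpLapφ)
  by_contra! hlt
  -- Replace `φ` by a compactly supported function touching `u` strictly.
  obtain ⟨Φ, hΦ, hΦc, hΦeq⟩ := exists_contDiff_hasCompactSupport_eventuallyEq isOpen_univ
    (hφ₁.sub (contDiff_norm_sub_pow_four x₀)).contDiffOn (mem_univ x₀)
  have hΦx₀ : Φ x₀ = u x₀ := by
    rw [hΦeq.eq_of_nhds, ← hφx₀, ← hφ₁φ.eq_of_nhds]
    simp
  have hlap₀ : pLap p Φ x₀ = pLap p φ x₀ := by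
    rw [hΦeq.pLap_eq p, ← hφ₁φ.pLap_eq p]
    exact pLap_sub_norm_sub_pow_four_self p hφ₁ x₀
  have hgrad₀ : gradient Φ x₀ = gradient φ x₀ := by
    rw [hΦeq.gradient_eq, ← hφ₁φ.gradient_eq]
    exact gradient_sub_norm_sub_pow_four_self hφ₁ x₀
  rw [← hlap₀, ← hgrad₀, neg_lt_iff_pos_add] at hlt
  have hΦg := (contDiff_gradient hΦ).continuous
  obtain ⟨CΦ, hCΦ⟩ := ContDiff.lipschitzWith_of_hasCompactSupport hΦc hΦ (by norm_num)
  -- Localize to a ball on which `u` is Lipschitz.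
  obtain ⟨K, t, ht, hKt⟩ := huLip hx₀
  rw [hΩo.nhdsWithin_eq hx₀] at ht
  have hFc : ContinuousOn (fun z : Euc n × Euc n => f z.1 (u z.1) z.2 + pLap p Φ z.1)
      (Ω ×ˢ univ) := by
    refine ContinuousOn.add ?_ ((continuous_pLap hp hΦ).comp continuous_fst).continuousOn
    have h1 : ContinuousOn (fun z : Euc n × Euc n => (z.1, u z.1, z.2)) (Ω ×ˢ univ) :=
      continuousOn_fst.prodMk
        ((huLip.continuousOn.comp continuousOn_fst fun z hz => hz.1).prodMk continuousOn_snd)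
    exact hfc.comp h1 fun z hz => ⟨hz.1, mem_univ _, mem_univ _⟩
  obtain ⟨δ, hδ, hδlt⟩ := exists_between hlt
  have hFev : ∀ᶠ z in 𝓝 (x₀, gradient Φ x₀), δ < f z.1 (u z.1) z.2 + pLap p Φ z.1 :=
    (hFc.continuousAt ((hΩo.prod isOpen_univ).mem_nhds ⟨hx₀, mem_univ _⟩)).eventually
      (lt_mem_nhds (by simpa [add_comm] using hδlt))
  obtain ⟨ε, hε, hεF⟩ := Metric.eventually_nhds_iff_ball.1 hFev
  have hnhds : ∀ᶠ x in 𝓝 x₀, x ∈ t ∧ x ∈ Ω ∧ Φ x = φ x - ‖x - x₀‖ ^ 4 ∧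
      x ∈ ball x₀ ε ∧ gradient Φ x ∈ ball (gradient Φ x₀) (ε / 2) := by
    filter_upwards [ht, hΩo.mem_nhds hx₀, hΦeq, hφ₁φ, ball_mem_nhds x₀ hε,
      hΦg.continuousAt.preimage_mem_nhds (ball_mem_nhds (gradient Φ x₀) (half_pos hε))]
      with x h1 h2 h3 h4 h5 h6
    exact ⟨h1, h2, by rw [h3, h4], h5, h6⟩
  obtain ⟨R, hR, hRsub⟩ := nhds_basis_closedBall.mem_iff.1 hnhds
  have hBsub : ball x₀ R ⊆ closedBall x₀ R := ball_subset_closedBall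
  have hBΩ : closedBall x₀ R ⊆ Ω := fun x hx => (hRsub hx).2.1
  obtain ⟨v, hv, huv⟩ := (hKt.mono fun x hx => (hRsub hx).1 :
    LipschitzOnWith K u (closedBall x₀ R)).extend_real
  have hguv (x) (hx : x ∈ ball x₀ R) : gradient u x = gradient v x :=
    Filter.EventuallyEq.gradient_eq <| by
      filter_upwards [isOpen_ball.mem_nhds hx] with y hy using huv (hBsub hy)
  set F : Euc n × Euc n → ℝ := fun z => f z.1 (u z.1) z.2 + pLap p Φ z.1 with hF
  obtain ⟨M, hM⟩ := ((isCompact_closedBall x₀ R).prod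
    (isCompact_closedBall (0 : Euc n) K)).exists_bound_of_continuousOn
      (hFc.mono (prod_mono hBΩ (subset_univ _)))
  have hM0 : 0 ≤ M := (norm_nonneg _).trans
    (hM (x₀, 0) ⟨mem_closedBall_self hR.le, mem_closedBall_self K.2⟩)
  set g : Euc n → ℝ := fun x => (ball x₀ R ×ˢ univ).indicator F (x, gradient v x) with hg
  have hgB (x) (hx : x ∈ ball x₀ R) : g x = F (x, gradient v x) :=
    indicator_of_mem (show (x, gradient v x) ∈ ball x₀ R ×ˢ univ from ⟨hx, mem_univ _⟩) F
  have hgM (x) : |g x| ≤ M := by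
    by_cases hx : x ∈ ball x₀ R
    · rw [hgB x hx]
      exact hM _ ⟨hBsub hx, by simpa using hv.norm_gradient_le x⟩
    · rw [show g x = 0 from indicator_of_notMem (fun h => hx h.1) F, abs_zero]
      exact hM0
  have hgmeas : Measurable g := by
    have hFm : Measurable ((ball x₀ R ×ˢ univ).indicator F) := by
      classical
      rw [← piecewise_eq_indicator]
      exact (hFc.mono (prod_mono (hBsub.trans hBΩ) (subset_univ _))).measurable_piecewise
        continuous_zero.continuousOn (isOpen_ball.prod isOpen_univ).measurableSet
    exact hFm.comp (measurable_id.prodMk (measurable_gradient v))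
  set G : Euc n → Euc n := fun x => pFlux p (gradient v x) - pFlux p (gradient Φ x) with hG
  have hGmeas : AEStronglyMeasurable G :=
    ((measurable_pFlux_gradient hp v).sub (measurable_pFlux_gradient hp Φ)).aestronglyMeasurable
  have hGM (x) : ‖G x‖ ≤ (K : ℝ) ^ (p - 1) + (CΦ : ℝ) ^ (p - 1) :=
    (norm_sub_le _ _).trans (add_le_add (norm_pFlux_gradient_le hp hv x)
      (norm_pFlux_gradient_le hp hCΦ x))
  -- The test function: the positive part of `Φ + s ^ 4 - u` near `x₀`.
  set κ : ℝ := (ε / 2 / 2) ^ (p - 2) * (ε / 2) ^ 2 / 2 with hκ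
  have hκ0 : 0 < κ := by positivity
  obtain ⟨s, hs0, hs⟩ := exists_between (show 0 < min (min 1 (R / 3)) (κ / (M + δ)) by positivity)
  obtain ⟨hs', hsκ⟩ := lt_min_iff.1 hs
  obtain ⟨hs1, hsR⟩ := lt_min_iff.1 hs'
  have hsκ' : (M + δ) * s ^ 4 ≤ κ := by
    have h4 : s ^ 4 ≤ s := by
      simpa using pow_le_pow_of_le_one hs0.le hs1.le (show 1 ≤ 4 by norm_num)
    rw [lt_div_iff₀ (by positivity)] at hsκ
    nlinarith
  obtain ⟨L, w, hwL, hwsupp, hw0, hwle, hwx₀, hwloc⟩ := exists_lipschitz_bump hCΦ hv hs0 hs1.le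
    (by linarith : 3 * s ≤ R) (hΦx₀.trans (huv (mem_closedBall_self hR.le)))
    fun x hx => by
      rw [← huv (hBsub hx), (hRsub (hBsub hx)).2.2.1]
      linarith [hφu x (hBΩ (hBsub hx))]
  have hwc : HasCompactSupport w :=
    (isCompact_closedBall x₀ s).of_isClosed_subset (isClosed_tsupport _) hwsupp
  have hwB : tsupport w ⊆ ball x₀ R := hwsupp.trans (closedBall_subset_ball (by linarith))
  have hmain : ∫ x, g x * w x ≤ ∫ x, ⟪G x, gradient w x⟫ :=
    integral_le_integral_inner_of_lipschitz hGmeas hgmeas.aestronglyMeasurable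
      (fun x => (hGM x).trans (le_max_right M _)) (fun x => (hgM x).trans (le_max_left _ _))
      isOpen_ball
      (fun ψ h1 h2 h3 h4 => hweak.integral_le_integral_inner_sub hp (hBsub.trans hBΩ) hv hguv hΦ
        hΦc hgmeas.aestronglyMeasurable hgM hgB h1 h2 h3 h4) hwL hwc hw0 hwB
  have hpt : ∀ᵐ x, ⟪G x, gradient w x⟫ + δ * w x ≤ g x * w x := by
    filter_upwards [hv.ae_differentiableAt] with x hvx
    rcases (hw0 x).eq_or_lt with hx0 | hxpos
    · have h1 : gradient w x = 0 := by
        have : IsLocalMin w x := .of_forall fun y => by rw [← hx0]; exact hw0 y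
        simp [gradient, this.fderiv_eq_zero]
      simp [h1, ← hx0]
    have hxB : x ∈ ball x₀ R := hwB (subset_tsupport _ hxpos.ne')
    have hgw : gradient w x = gradient Φ x - gradient v x := by
      refine ext_inner_right ℝ fun y => ?_
      rw [inner_sub_left, inner_gradient_left, inner_gradient_left, inner_gradient_left,
        (hwloc x hxpos).fderiv_eq, ((((hΦ.differentiable (by norm_num) x).hasFDerivAt).add_const
          (s ^ 4)).fun_sub hvx.hasFDerivAt).fderiv]
      rfl
    have hmono := le_inner_pFlux_sub hp (gradient Φ x) (gradient v x)
    have hGw : ⟪G x, gradient w x⟫ = -⟪pFlux p (gradient Φ x) - pFlux p (gradient v x),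
        gradient Φ x - gradient v x⟫ := by
      rw [hgw, ← inner_neg_left, neg_sub]
    rw [hGw]
    rcases lt_or_ge ‖gradient Φ x - gradient v x‖ (ε / 2) with hclose | hfar
    · have hδg : δ < g x := by
        rw [hgB x hxB]
        refine hεF _ ?_
        rw [← ball_prod_same]
        refine ⟨(hRsub (hBsub hxB)).2.2.2.1, ?_⟩
        have h1 := (hRsub (hBsub hxB)).2.2.2.2
        have h2 := dist_triangle (gradient v x) (gradient Φ x) (gradient Φ x₀)
        rw [mem_ball] at h1 ⊢
        rw [dist_comm (gradient v x) (gradient Φ x),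
          dist_eq_norm (gradient Φ x) (gradient v x)] at h2
        change dist (gradient v x) (gradient Φ x₀) < ε
        linarith
      have h0 : 0 ≤ (‖gradient Φ x - gradient v x‖ / 2) ^ (p - 2) *
          ‖gradient Φ x - gradient v x‖ ^ 2 / 2 := by positivity
      have := mul_le_mul_of_nonneg_right hδg.le (hw0 x)
      linarith
    · have h0 : κ ≤ (‖gradient Φ x - gradient v x‖ / 2) ^ (p - 2) *
          ‖gradient Φ x - gradient v x‖ ^ 2 / 2 := by
        have := Real.rpow_le_rpow (by positivity) (div_le_div_of_nonneg_right hfar zero_le_two)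
          (by linarith : 0 ≤ p - 2)
        rw [hκ]
        gcongr
      have h1 := mul_le_mul_of_nonneg_right (neg_le_of_abs_le (hgM x)) (hw0 x)
      have h2 := mul_le_mul_of_nonneg_left (hwle x) (by positivity : 0 ≤ M + δ)
      linarith
  have hint1 : Integrable fun x => ⟪G x, gradient w x⟫ :=
    integrable_inner_gradient hGmeas hGM hwL hwc
  have hint2 : Integrable w := hwL.continuous.integrable_of_hasCompactSupport hwc
  have hint3 : Integrable fun x => g x * w x :=
    integrable_mul_of_bounded hgmeas.aestronglyMeasurable hgM hwL.continuous hwc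
  have hle := integral_mono_ae (hint1.add (hint2.const_mul δ)) hint3 hpt
  have hadd : ∫ x, (⟪G x, gradient w x⟫ + δ * w x) =
      (∫ x, ⟪G x, gradient w x⟫) + δ * ∫ x, w x := by
    rw [integral_add hint1 (hint2.const_mul δ), integral_const_mul]
  have hpos : 0 < ∫ x, w x :=
    hwL.continuous.integral_pos_of_hasCompactSupport_nonneg_nonzero hwc hw0 hwx₀.ne'
  have := mul_pos hδ hpos
  simp only [Pi.add_apply] at hle
  linarith

end
end

section
/- Let Ω ⊂ ℝⁿ be open and bounded, 1 < p < 2, and q > p/(p−1) (note q > 2). Let f : Ω × ℝ × ℝⁿ → ℝ be continuous and non-increasing in its second variable s, and suppose u : Ω → ℝ is bounded, lower semicontinuous, and a viscosity supersolution of −Δ_p u = f(x,u,∇u) in Ω. Let u_ε be the infimal convolution of u with exponent q and let f_ε(x,s,η) = inf_{y ∈ B_{r(ε)}(x)} f(y,s,η). If x̂ ∈ Ω with dist(x̂,∂Ω) > r(ε) is a point at which u_ε is differentiable and ∇u_ε(x̂) = 0, then f_ε(x̂, u_ε(x̂), 0) ≤ 0. -/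
open MeasureTheory Metric Set Filter
open scoped RealInnerProductSpace ENNReal Topology NNReal

noncomputable section

variable {n : ℕ}

section NormRpow

variable {E : Type*} [NormedAddCommGroup E] [InnerProductSpace ℝ E]

/-- The derivative of `x ↦ ‖x‖ ^ s • x` at `x`. -/
def normRpowSMulDeriv (s : ℝ) (x : E) : E →L[ℝ] E :=
  ‖x‖ ^ s • ContinuousLinearMap.id ℝ E +
    (s * ‖x‖ ^ (s - 2)) • (innerSL ℝ x).smulRight x

theorem norm_normRpowSMulDeriv_le {s : ℝ} (hs : 0 < s) (x : E) :
    ‖normRpowSMulDeriv s x‖ ≤ (1 + s) * ‖x‖ ^ s := by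
  have hsplit : ‖x‖ ^ (s - 2) * (‖x‖ * ‖x‖) = ‖x‖ ^ s := by
    rcases eq_or_ne x 0 with rfl | hx
    · simp [hs.ne']
    · have hx' : 0 < ‖x‖ := norm_pos_iff.2 hx
      rw [Real.rpow_sub hx', Real.rpow_two]
      field_simp
  have hid : ‖‖x‖ ^ s • ContinuousLinearMap.id ℝ E‖ ≤ ‖x‖ ^ s := by
    rw [norm_smul, Real.norm_of_nonneg (by positivity)]
    exact mul_le_of_le_one_right (by positivity) ContinuousLinearMap.norm_id_le
  calc ‖normRpowSMulDeriv s x‖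
      ≤ ‖x‖ ^ s + s * (‖x‖ ^ (s - 2) * (‖x‖ * ‖x‖)) := by
        refine (norm_add_le _ _).trans (add_le_add hid ?_)
        rw [norm_smul, ContinuousLinearMap.norm_smulRight_apply, innerSL_apply_norm,
          Real.norm_of_nonneg (by positivity), mul_assoc]
    _ = (1 + s) * ‖x‖ ^ s := by rw [hsplit]; ring

theorem hasFDerivAt_norm_rpow_of_ne_zero {x : E} (hx : x ≠ 0) (s : ℝ) :
    HasFDerivAt (fun y : E => ‖y‖ ^ s) ((s * ‖x‖ ^ (s - 2)) • innerSL ℝ x) x := by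
  apply HasStrictFDerivAt.hasFDerivAt
  convert! (hasStrictFDerivAt_norm_sq x).rpow_const (p := s / 2) (by simp [hx]) using 0
  simp_rw [← Real.rpow_natCast_mul (norm_nonneg _), ← Nat.cast_smul_eq_nsmul ℝ, smul_smul]
  ring_nf

theorem hasFDerivAt_norm_rpow_smul {s : ℝ} (hs : 0 < s) (x : E) :
    HasFDerivAt (fun y : E => ‖y‖ ^ s • y) (normRpowSMulDeriv s x) x := by
  rcases eq_or_ne x 0 with rfl | hx
  · have hzero : normRpowSMulDeriv s (0 : E) = 0 := by simp [normRpowSMulDeriv, hs.ne']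
    rw [hzero]
    refine .of_isLittleO ?_
    simp only [norm_zero, smul_zero, sub_zero, zero_apply]
    have hlim : Tendsto (fun y : E => ‖y‖ ^ s) (𝓝 0) (𝓝 0) := by
      have := (continuous_norm (E := E)).rpow_const (fun _ => Or.inr hs.le) |>.tendsto 0
      simpa [hs.ne'] using this
    have := ((Asymptotics.isLittleO_one_iff ℝ).2 hlim).smul_isBigO
      (Asymptotics.isBigO_refl (fun y : E => y) (𝓝 0))
    simpa using this
  · convert! (hasFDerivAt_norm_rpow_of_ne_zero hx s).smul (hasFDerivAt_id x) using 1
    ext v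
    simp [normRpowSMulDeriv, mul_smul]

theorem continuous_normRpowSMulDeriv {s : ℝ} (hs : 0 < s) :
    Continuous (normRpowSMulDeriv s : E → E →L[ℝ] E) := by
  refine continuous_iff_continuousAt.2 fun x => ?_
  rcases eq_or_ne x 0 with rfl | hx
  · have hzero : normRpowSMulDeriv s (0 : E) = 0 := by simp [normRpowSMulDeriv, hs.ne']
    rw [ContinuousAt, hzero]
    refine squeeze_zero_norm (norm_normRpowSMulDeriv_le hs) ?_
    have := ((continuous_norm (E := E)).rpow_const (fun _ => Or.inr hs.le)).const_mul (1 + s)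
      |>.tendsto 0
    simpa [hs.ne'] using this
  · have hx' : ‖x‖ ≠ 0 := norm_ne_zero_iff.2 hx
    have hpow (t : ℝ) : ContinuousAt (fun y : E => ‖y‖ ^ t) x :=
      continuousAt_id.norm.rpow_const (Or.inl hx')
    have hrank : Continuous fun y : E => (innerSL ℝ y).smulRight y :=
      ((ContinuousLinearMap.smulRightL ℝ E E).continuous.comp
        (innerSL ℝ).continuous).clm_apply continuous_id
    exact ((hpow s).smul continuousAt_const).add
      (((hpow (s - 2)).const_mul s).smul hrank.continuousAt)

theorem contDiff_norm_rpow_smul {s : ℝ} (hs : 0 < s) :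
    ContDiff ℝ 1 (fun x : E => ‖x‖ ^ s • x) := by
  rw [contDiff_one_iff_fderiv]
  refine ⟨fun x => (hasFDerivAt_norm_rpow_smul hs x).differentiableAt, ?_⟩
  have hfderiv : fderiv ℝ (fun x : E => ‖x‖ ^ s • x) = normRpowSMulDeriv s :=
    funext fun x => (hasFDerivAt_norm_rpow_smul hs x).fderiv
  rw [hfderiv]
  exact continuous_normRpowSMulDeriv hs

theorem contDiff_two_norm_rpow {q : ℝ} (hq : 2 < q) :
    ContDiff ℝ 2 (fun x : E => ‖x‖ ^ q) := by
  rw [← one_add_one_eq_two, contDiff_succ_iff_fderiv]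
  refine ⟨differentiable_norm_rpow (by linarith), by simp, ?_⟩
  have hfderiv : fderiv ℝ (fun x : E => ‖x‖ ^ q) =
      fun x => q • innerSL ℝ (‖x‖ ^ (q - 2) • x) := by
    funext x
    rw [fderiv_norm_rpow x (by linarith), map_smul, smul_smul]
  rw [hfderiv]
  exact ((innerSL ℝ).contDiff.comp (contDiff_norm_rpow_smul (by linarith))).const_smul q

theorem hasGradientAt_norm_sub_rpow [CompleteSpace E] {q : ℝ} (hq : 1 < q) (a c : ℝ) (x z : E) :
    HasGradientAt (fun y => a + c * ‖y - x‖ ^ q)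
      ((c * q) • ‖z - x‖ ^ (q - 2) • (z - x)) z := by
  rw [hasGradientAt_iff_hasFDerivAt]
  have h := (((hasFDerivAt_norm_rpow (z - x) hq).comp z
    ((hasFDerivAt_id z).sub_const x)).const_mul c).const_add a
  refine h.congr_fderiv ?_
  ext v
  simp
  ring

end NormRpow

theorem trace_normRpowSMulDeriv {s : ℝ} {w : Euc n} (hw : w ≠ 0) :
    LinearMap.trace ℝ (Euc n) (normRpowSMulDeriv s w).toLinearMap = (n + s) * ‖w‖ ^ s := by
  have hw' : 0 < ‖w‖ := norm_pos_iff.2 hw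
  have hlin : (normRpowSMulDeriv s w).toLinearMap = ‖w‖ ^ s • (LinearMap.id : Euc n →ₗ[ℝ] Euc n) +
      (s * ‖w‖ ^ (s - 2)) • (innerSL ℝ w).toLinearMap.smulRight w := rfl
  rw [hlin, map_add, map_smul, map_smul, LinearMap.trace_id, LinearMap.trace_smulRight]
  simp [Real.rpow_sub hw']
  field_simp

theorem normRpowSMulDeriv_apply_self {E : Type*} [NormedAddCommGroup E] [InnerProductSpace ℝ E]
    {s : ℝ} {w : E} (hw : w ≠ 0) :
    normRpowSMulDeriv s w w = ((1 + s) * ‖w‖ ^ s) • w := by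
  have hw' : 0 < ‖w‖ := norm_pos_iff.2 hw
  have hpow : s * ‖w‖ ^ (s - 2) * ‖w‖ ^ 2 = s * ‖w‖ ^ s := by
    rw [Real.rpow_sub hw', Real.rpow_two]
    field_simp
  simp only [normRpowSMulDeriv, add_apply, smul_apply,
    ContinuousLinearMap.smulRight_apply, ContinuousLinearMap.id_apply, innerSL_apply_apply,
    real_inner_self_eq_norm_sq, smul_smul, ← add_smul, hpow]
  ring_nf

/-- The p-Laplacian of a radial power with negative coefficient. -/
theorem pLap_sub_norm_rpow {p q c : ℝ} (hq : 2 < q) (hc : 0 < c) (a : ℝ) {x z : Euc n}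
    (hz : z ≠ x) :
    pLap p (fun y => a + -c * ‖y - x‖ ^ q) z =
      -((c * q) ^ (p - 1) * (n + (q - 2) + (p - 2) * (q - 1)) * ‖z - x‖ ^ (q * (p - 1) - p)) := by
  have hw : z - x ≠ 0 := sub_ne_zero.2 hz
  have hw' : 0 < ‖z - x‖ := norm_pos_iff.2 hw
  have hk : 0 < c * q := by positivity
  have hgrad : gradient (fun y => a + -c * ‖y - x‖ ^ q) =
      fun z => (-c * q) • ‖z - x‖ ^ (q - 2) • (z - x) :=
    gradient_eq fun z => hasGradientAt_norm_sub_rpow (by linarith) a (-c) x z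
  have hfderiv : fderiv ℝ (fun z => (-c * q) • ‖z - x‖ ^ (q - 2) • (z - x)) z =
      (-c * q) • normRpowSMulDeriv (q - 2) (z - x) := by
    have h := ((hasFDerivAt_norm_rpow_smul (s := q - 2) (by linarith) (z - x)).comp z
      ((hasFDerivAt_id z).sub_const x)).const_smul (-c * q)
    exact h.fderiv
  unfold pLap
  rw [hgrad, hfderiv]
  set w := z - x
  have hnorm : ‖(-c * q) • ‖w‖ ^ (q - 2) • w‖ = c * q * ‖w‖ ^ (q - 1) := by
    rw [norm_smul, norm_smul, neg_mul, norm_neg, Real.norm_of_nonneg hk.le,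
      Real.norm_of_nonneg (by positivity), ← Real.rpow_add_one hw'.ne']
    ring_nf
  have hinner : ⟪((-c * q) • normRpowSMulDeriv (q - 2) w) ((-c * q) • ‖w‖ ^ (q - 2) • w),
      (-c * q) • ‖w‖ ^ (q - 2) • w⟫ =
      -(c * q) * ((q - 1) * ‖w‖ ^ (q - 2)) * (c * q * ‖w‖ ^ (q - 1)) ^ 2 := by
    rw [← hnorm, ← real_inner_self_eq_norm_sq]
    simp only [smul_apply, map_smul, normRpowSMulDeriv_apply_self hw,
      inner_smul_left, inner_smul_right, conj_trivial]
    ring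
  have htrace : LinearMap.trace ℝ (Euc n)
      ((-c * q) • normRpowSMulDeriv (q - 2) w).toLinearMap =
      -(c * q) * ((n + (q - 2)) * ‖w‖ ^ (q - 2)) := by
    rw [ContinuousLinearMap.toLinearMap_smul, map_smul, trace_normRpowSMulDeriv hw, smul_eq_mul]
    ring
  have hpow : (c * q * ‖w‖ ^ (q - 1)) ^ (p - 2) * (c * q * ‖w‖ ^ (q - 2)) =
      (c * q) ^ (p - 1) * ‖w‖ ^ (q * (p - 1) - p) := by
    rw [Real.mul_rpow hk.le (by positivity), ← Real.rpow_mul hw'.le,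
      show p - 1 = (p - 2) + 1 by ring, Real.rpow_add_one hk.ne',
      show q * (p - 2 + 1) - p = (q - 1) * (p - 2) + (q - 2) by ring, Real.rpow_add hw']
    ring
  rw [hnorm, hinner, htrace]
  have hne : (c * q * ‖w‖ ^ (q - 1)) ^ 2 ≠ 0 := by positivity
  rw [div_mul_eq_mul_div, ← mul_assoc (p - 2), mul_div_cancel_right₀ _ hne]
  linear_combination (-(n + (q - 2) + (p - 2) * (q - 1))) * hpow

theorem limsupPunct_le_of_tendsto {g h : Euc n → ℝ} {x₀ : Euc n} {l : ℝ}
    (hgh : ∀ x ≠ x₀, g x = h x) (hh : Tendsto h (𝓝 x₀) (𝓝 l)) :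
    limsupPunct g x₀ ≤ l := by
  refine EReal.le_of_forall_lt_iff_le.1 fun b hb => ?_
  obtain ⟨r, hr, hball⟩ := Metric.eventually_nhds_iff_ball.1
    (hh.eventually_lt_const (EReal.coe_lt_coe_iff.1 hb))
  refine (iInf₂_le r hr).trans (iSup₂_le fun x hx => ?_)
  rw [hgh x hx.2]
  exact EReal.coe_le_coe_iff.2 (hball x hx.1).le

/-- If a multiple of `‖z - x₀‖ ^ q` touches a viscosity supersolution from below at `x₀`, then the
right-hand side of the equation is nonpositive there. -/
theorem IsViscositySupersolution.nonpos_of_touching {p q c : ℝ} {f : Euc n → ℝ → Euc n → ℝ}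
    {Ω : Set (Euc n)} {u : Euc n → ℝ} (hvisc : IsViscositySupersolution p f Ω u)
    (hq2 : 2 < q) (hpq : p < q * (p - 1)) (hc : 0 < c) {x₀ : Euc n} (hx₀ : x₀ ∈ Ω)
    (htouch : ∀ z ∈ Ω, u x₀ ≤ u z + c * ‖z - x₀‖ ^ q) :
    f x₀ (u x₀) 0 ≤ 0 := by
  have hgrad (z : Euc n) := hasGradientAt_norm_sub_rpow (by linarith) (u x₀) (-c) x₀ z (q := q)
  have hlim : Tendsto (fun z => (c * q) ^ (p - 1) * (n + (q - 2) + (p - 2) * (q - 1)) *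
      ‖z - x₀‖ ^ (q * (p - 1) - p)) (𝓝 x₀) (𝓝 0) := by
    have hpos : 0 < q * (p - 1) - p := by linarith
    have hcont : Continuous fun z : Euc n => (c * q) ^ (p - 1) *
        (n + (q - 2) + (p - 2) * (q - 1)) * ‖z - x₀‖ ^ (q * (p - 1) - p) :=
      ((continuous_id.sub continuous_const).norm.rpow_const fun _ => Or.inr hpos.le).const_mul _
    simpa [hpos.ne'] using hcont.tendsto x₀
  have hC2 : ContDiff ℝ 2 fun z => u x₀ + -c * ‖z - x₀‖ ^ q :=
    contDiff_const.add (contDiff_const.mul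
      ((contDiff_two_norm_rpow hq2).comp (contDiff_id.sub contDiff_const)))
  have h := hvisc x₀ hx₀ (fun z => u x₀ + -c * ‖z - x₀‖ ^ q) hC2.contDiffOn
    (by simp [show q ≠ 0 by linarith])
    (fun z hz => by linarith [htouch z hz])
    (fun z _ hz => by
      have hw : z - x₀ ≠ 0 := sub_ne_zero.2 hz
      have hw' : 0 < ‖z - x₀‖ := norm_pos_iff.2 hw
      rw [(hgrad z).gradient]
      exact smul_ne_zero (mul_ne_zero (neg_ne_zero.2 hc.ne') (by linarith))
        (smul_ne_zero (Real.rpow_pos_of_pos hw' _).ne' hw))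
  rw [(hgrad x₀).gradient, sub_self, smul_zero, smul_zero] at h
  have hle := h.trans (limsupPunct_le_of_tendsto
    (fun z hz => by rw [pLap_sub_norm_rpow hq2 hc _ hz, neg_neg]) hlim)
  exact EReal.coe_le_coe_iff.1 hle

section InfConv

variable {u : Euc n → ℝ} {Ω : Set (Euc n)} {q ε : ℝ}

theorem infConv_le (hubdd : ∃ C, ∀ x ∈ Ω, |u x| ≤ C) (hq : 0 < q) (hε : 0 < ε) (x : Euc n)
    {y : Euc n} (hy : y ∈ Ω) :
    infConv u Ω q ε x ≤ u y + ‖x - y‖ ^ q / (q * ε ^ (q - 1)) := by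
  obtain ⟨C, hC⟩ := hubdd
  refine ciInf_le (f := fun y : Ω => u y + ‖x - (y : Euc n)‖ ^ q / (q * ε ^ (q - 1)))
    ⟨-C, ?_⟩ ⟨y, hy⟩
  rintro _ ⟨z, rfl⟩
  have h₁ := (abs_le.1 (hC z z.2)).1
  have h₂ : 0 ≤ ‖x - (z : Euc n)‖ ^ q / (q * ε ^ (q - 1)) := by positivity
  simp only
  linarith

theorem sub_le_oscOn (hubdd : ∃ C, ∀ x ∈ Ω, |u x| ≤ C) {x y : Euc n} (hx : x ∈ Ω) (hy : y ∈ Ω) :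
    u x - u y ≤ oscOn u Ω := by
  obtain ⟨C, hC⟩ := hubdd
  refine sub_le_sub (le_csSup ⟨C, ?_⟩ (mem_image_of_mem u hx))
    (csInf_le ⟨-C, ?_⟩ (mem_image_of_mem u hy))
  · rintro _ ⟨z, hz, rfl⟩
    exact (abs_le.1 (hC z hz)).2
  · rintro _ ⟨z, hz, rfl⟩
    exact (abs_le.1 (hC z hz)).1

theorem rEps_pos (hubdd : ∃ C, ∀ x ∈ Ω, |u x| ≤ C) (hne : Ω.Nonempty) (hq : 0 < q) (hε : 0 < ε) :
    0 < rEps u Ω q ε := by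
  obtain ⟨x, hx⟩ := hne
  have := sub_le_oscOn hubdd hx hx
  have hosc : 0 < oscOn u Ω + 1 := by linarith
  unfold rEps
  positivity

/-- Points at distance at least `r(ε)` do not compete in the infimal convolution. -/
theorem lt_of_rEps_le_norm (hubdd : ∃ C, ∀ x ∈ Ω, |u x| ≤ C) (hq : 0 < q) (hε : 0 < ε)
    {x y : Euc n} (hx : x ∈ Ω) (hy : y ∈ Ω) (hxy : rEps u Ω q ε ≤ ‖x - y‖) :
    u x < u y + ‖x - y‖ ^ q / (q * ε ^ (q - 1)) := by
  have hosc := sub_le_oscOn hubdd hx hy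
  have hosc' := sub_le_oscOn hubdd hx hx
  have hpow : q * ε ^ (q - 1) * (oscOn u Ω + 1) ≤ ‖x - y‖ ^ q := by
    have hnn : 0 ≤ q * ε ^ (q - 1) * (oscOn u Ω + 1) :=
      mul_nonneg (by positivity) (by linarith)
    have h := Real.rpow_le_rpow (rEps_pos hubdd ⟨x, hx⟩ hq hε).le hxy hq.le
    rwa [rEps, ← Real.rpow_mul hnn, one_div_mul_cancel hq.ne', Real.rpow_one] at h
  have hdiv : oscOn u Ω + 1 ≤ ‖x - y‖ ^ q / (q * ε ^ (q - 1)) := by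
    rw [le_div_iff₀ (by positivity)]
    linarith
  linarith

/-- The infimal convolution is attained at points farther than `r(ε)` from the complement. -/
theorem exists_infConv_eq (hubdd : ∃ C, ∀ x ∈ Ω, |u x| ≤ C) (hulsc : LowerSemicontinuousOn u Ω)
    (hq : 0 < q) (hε : 0 < ε) {x : Euc n} (hx : x ∈ Ω)
    (hdist : rEps u Ω q ε < infDist x Ωᶜ) :
    ∃ y ∈ Ω, infConv u Ω q ε x = u y + ‖x - y‖ ^ q / (q * ε ^ (q - 1)) := by
  have hr := rEps_pos hubdd ⟨x, hx⟩ hq hε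
  have hsub : closedBall x (rEps u Ω q ε) ⊆ Ω := by
    intro y hy
    by_contra hyΩ
    have := infDist_le_dist_of_mem (x := x) (mem_compl hyΩ)
    rw [mem_closedBall, dist_comm] at hy
    linarith
  have hxball : x ∈ closedBall x (rEps u Ω q ε) := mem_closedBall_self hr.le
  have hcont : Continuous fun y : Euc n => ‖x - y‖ ^ q / (q * ε ^ (q - 1)) :=
    ((continuous_const.sub continuous_id).norm.rpow_const fun _ => Or.inr hq.le).div_const _
  obtain ⟨y, hy, hmin⟩ := LowerSemicontinuousOn.exists_isMinOn ⟨x, hxball⟩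
    (isCompact_closedBall x (rEps u Ω q ε))
    ((hulsc.mono hsub).add (hcont.lowerSemicontinuous.lowerSemicontinuousOn _))
  refine ⟨y, hsub hy, le_antisymm (infConv_le hubdd hq hε x (hsub hy)) ?_⟩
  have : Nonempty Ω := ⟨⟨x, hx⟩⟩
  refine le_ciInf fun z => ?_
  rcases le_total (rEps u Ω q ε) ‖x - (z : Euc n)‖ with hz | hz
  · have h := isMinOn_iff.1 hmin x hxball
    rw [sub_self, norm_zero, Real.zero_rpow hq.ne', zero_div, add_zero] at h
    exact h.trans (lt_of_rEps_le_norm hubdd hq hε hx z.2 hz).le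
  · exact hmin (by rwa [mem_closedBall, dist_comm, dist_eq_norm])

/-- At a critical point of the infimal convolution, the infimum is attained only at the point
itself. -/
theorem eq_of_gradient_infConv_eq_zero (hubdd : ∃ C, ∀ x ∈ Ω, |u x| ≤ C) (hq : 1 < q)
    (hε : 0 < ε) {x y : Euc n} (hy : y ∈ Ω)
    (hxy : infConv u Ω q ε x = u y + ‖x - y‖ ^ q / (q * ε ^ (q - 1)))
    (hdiff : DifferentiableAt ℝ (infConv u Ω q ε) x)
    (hgrad : gradient (infConv u Ω q ε) x = 0) : x = y := by
  by_contra hne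
  have hq0 : 0 < q := by linarith
  have hw : x - y ≠ 0 := sub_ne_zero.2 hne
  have hw' : 0 < ‖x - y‖ := norm_pos_iff.2 hw
  have hsub := (hasGradientAt_norm_sub_rpow hq (u y) (q * ε ^ (q - 1))⁻¹ y x).hasFDerivAt.sub
    hdiff.hasGradientAt.hasFDerivAt
  have hmin : IsLocalMin ((fun z => u y + (q * ε ^ (q - 1))⁻¹ * ‖z - y‖ ^ q) -
      infConv u Ω q ε) x := by
    refine Filter.Eventually.of_forall fun z => ?_
    have h := infConv_le hubdd hq0 hε z hy
    rw [div_eq_inv_mul] at h hxy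
    simp only [Pi.sub_apply, hxy]
    linarith
  have hzero := hmin.hasFDerivAt_eq_zero hsub
  rw [hgrad, map_zero, sub_zero, map_eq_zero_iff _ (LinearIsometryEquiv.injective _)] at hzero
  refine smul_ne_zero (by positivity) (smul_ne_zero (Real.rpow_pos_of_pos hw' _).ne' hw) hzero

end InfConv

/-- **Lemma 3.1.** In the singular case `1 < p < 2` (with `q > p/(p-1)`), at any point of
`Ω_ε` where the infimal convolution `u_ε` is differentiable with vanishing gradient,
`f_ε(xhat, u_ε(xhat), ∇u_ε(xhat)) ≤ 0`. -/
theorem fEps_nonpos_at_critical_points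
    (n : ℕ) (Ω : Set (Euc n)) (hΩo : IsOpen Ω) (hΩb : Bornology.IsBounded Ω)
    (p : ℝ) (hp1 : 1 < p) (hp2 : p < 2)
    (q : ℝ) (hq : p / (p - 1) < q)
    (f : Euc n → ℝ → Euc n → ℝ)
    (hfc : ContinuousOn (fun w : Euc n × ℝ × Euc n => f w.1 w.2.1 w.2.2)
      (Ω ×ˢ (univ : Set ℝ) ×ˢ (univ : Set (Euc n))))
    (hfmono : NonincreasingInS f)
    (u : Euc n → ℝ) (hubdd : ∃ C, ∀ x ∈ Ω, |u x| ≤ C)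
    (hulsc : LowerSemicontinuousOn u Ω)
    (hvisc : IsViscositySupersolution p f Ω u)
    (ε : ℝ) (hε : 0 < ε)
    (xhat : Euc n) (hxhat : xhat ∈ Ω) (hdist : rEps u Ω q ε < Metric.infDist xhat Ωᶜ)
    (hdiff : DifferentiableAt ℝ (infConv u Ω q ε) xhat)
    (hgrad0 : gradient (infConv u Ω q ε) xhat = 0) :
    fEps f (rEps u Ω q ε) xhat (infConv u Ω q ε xhat) (gradient (infConv u Ω q ε) xhat) ≤ 0 := by
  have hp0 : 0 < p - 1 := by linarith
  have hpq : p < q * (p - 1) := (div_lt_iff₀ hp0).1 hq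
  have hq2 : 2 < q := by
    refine lt_trans ?_ hq
    rw [lt_div_iff₀ hp0]
    linarith
  have hq0 : 0 < q := by linarith
  obtain ⟨y, hy, hmin⟩ := exists_infConv_eq hubdd hulsc hq0 hε hxhat hdist
  obtain rfl := eq_of_gradient_infConv_eq_zero hubdd (by linarith) hε hy hmin hdiff hgrad0
  rw [sub_self, norm_zero, Real.zero_rpow hq0.ne', zero_div, add_zero] at hmin
  have hf : f xhat (u xhat) 0 ≤ 0 := by
    refine hvisc.nonpos_of_touching hq2 hpq (c := (q * ε ^ (q - 1))⁻¹) (by positivity) hxhat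
      fun z hz => ?_
    have h := infConv_le hubdd hq0 hε xhat hz
    rwa [hmin, div_eq_inv_mul, norm_sub_rev] at h
  rw [hgrad0, hmin, fEps]
  by_cases hbdd : BddBelow (range fun z : ball xhat (rEps u Ω q ε) => f z (u xhat) 0)
  · exact (ciInf_le hbdd ⟨xhat, mem_ball_self (rEps_pos hubdd ⟨xhat, hxhat⟩ hq0 hε)⟩).trans hf
  · exact (Real.iInf_of_not_bddBelow hbdd).le

end
end

section
/- For every real p ≥ 2 and all vectors a, b ∈ ℝⁿ, the following monotonicity inequality for the p-Laplacian vector field holds: ( |a|^{p−2}a − |b|^{p−2}b ) · (a − b) ≥ 2^{2−p} |a − b|^p, where by convention |v|^{p−2}v := 0 when v = 0 (relevant only for p = 2, where the inequality is an identity). In particular the left-hand side is nonnegative for all a, b. -/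
open MeasureTheory Metric Set Filter
open scoped RealInnerProductSpace ENNReal Topology NNReal

noncomputable section

variable {n : ℕ}

/-- The power-mean inequality `((x + y) / 2) ^ (q + 1) ≤ (x ^ (q + 1) + y ^ (q + 1)) / 2`,
multiplied out. -/
lemma two_rpow_neg_mul_add_rpow_le {q x y : ℝ} (hq : 0 ≤ q) (hx : 0 ≤ x) (hy : 0 ≤ y) :
    (2 : ℝ) ^ (-q) * (x + y) ^ (q + 1) ≤ x ^ (q + 1) + y ^ (q + 1) := by
  lift x to ℝ≥0 using hx
  lift y to ℝ≥0 using hy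
  have h := NNReal.rpow_add_le_mul_rpow_add_rpow x y (p := q + 1) (by linarith)
  rw [add_sub_cancel_right] at h
  have h' : ((x : ℝ) + y) ^ (q + 1) ≤ 2 ^ q * ((x : ℝ) ^ (q + 1) + (y : ℝ) ^ (q + 1)) := by
    exact_mod_cast h
  rw [Real.rpow_neg (by norm_num), inv_mul_le_iff₀ (by positivity)]
  exact h'

lemma inner_smul_sub_smul_sub {E : Type*} [NormedAddCommGroup E] [InnerProductSpace ℝ E]
    (s t : ℝ) (a b : E) :
    ⟪s • a - t • b, a - b⟫ =
      (s + t) / 2 * ‖a - b‖ ^ 2 + (s - t) * (‖a‖ ^ 2 - ‖b‖ ^ 2) / 2 := by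
  rw [norm_sub_sq_real]
  simp only [inner_sub_left, inner_sub_right, real_inner_smul_left, real_inner_self_eq_norm_sq,
    real_inner_comm a b]
  ring

/-- Monotonicity of `v ↦ ‖v‖ ^ q • v` in a real inner product space. -/
lemma two_rpow_neg_mul_norm_sub_rpow_le_inner {E : Type*} [NormedAddCommGroup E]
    [InnerProductSpace ℝ E] {q : ℝ} (hq : 0 ≤ q) (a b : E) :
    (2 : ℝ) ^ (-q) * ‖a - b‖ ^ (q + 2) ≤ ⟪‖a‖ ^ q • a - ‖b‖ ^ q • b, a - b⟫ := by
  rw [inner_smul_sub_smul_sub]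
  have hd : ‖a - b‖ ≤ ‖a‖ + ‖b‖ := norm_sub_le a b
  have hd₀ : 0 ≤ ‖a - b‖ := norm_nonneg _
  have hA : 0 ≤ ‖a‖ := norm_nonneg a
  have hB : 0 ≤ ‖b‖ := norm_nonneg b
  generalize ‖a - b‖ = d at *
  generalize ‖a‖ = A at *
  generalize ‖b‖ = B at *
  have hpow : d ^ (q + 2) = d ^ q * d ^ 2 := by
    rw [Real.rpow_add_of_nonneg hd₀ hq zero_le_two, Real.rpow_two]
  have hmono : 0 ≤ (A ^ q - B ^ q) * (A - B) := by
    rcases le_total A B with h | h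
    · exact mul_nonneg_of_nonpos_of_nonpos
        (sub_nonpos.2 (Real.rpow_le_rpow hA h hq)) (sub_nonpos.2 h)
    · exact mul_nonneg (sub_nonneg.2 (Real.rpow_le_rpow hB h hq)) (sub_nonneg.2 h)
  have hdq : d ^ q ≤ (A + B) ^ q := Real.rpow_le_rpow hd₀ hd hq
  have hmean := two_rpow_neg_mul_add_rpow_le hq hA hB
  have split (x : ℝ) (hx : 0 ≤ x) : x ^ (q + 1) = x ^ q * x := by
    rw [Real.rpow_add_of_nonneg hx hq zero_le_one, Real.rpow_one]
  rw [split _ hA, split _ hB, split _ (add_nonneg hA hB)] at hmean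
  have hc : (0 : ℝ) < 2 ^ (-q) := by positivity
  generalize (2 : ℝ) ^ (-q) = c at *
  rw [hpow]
  rcases (add_nonneg hA hB).eq_or_lt with hS | hS
  · obtain rfl : d = 0 := by linarith
    obtain rfl : A = 0 := by linarith
    obtain rfl : B = 0 := by linarith
    simp
  · have hsq : d ^ 2 ≤ (A + B) * (A + B) := by nlinarith
    refine le_of_mul_le_mul_right ?_ hS
    calc c * (d ^ q * d ^ 2) * (A + B)
        = c * d ^ 2 * (A + B) * d ^ q := by ring
      _ ≤ c * d ^ 2 * (A + B) * (A + B) ^ q := by gcongr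
      _ = d ^ 2 * (c * ((A + B) ^ q * (A + B))) := by ring
      _ ≤ d ^ 2 * (A ^ q * A + B ^ q * B) := by gcongr
      _ = (A ^ q + B ^ q) / 2 * d ^ 2 * (A + B) + (A ^ q - B ^ q) * (A - B) * d ^ 2 / 2 := by ring
      _ ≤ (A ^ q + B ^ q) / 2 * d ^ 2 * (A + B) +
          (A ^ q - B ^ q) * (A - B) * ((A + B) * (A + B)) / 2 := by gcongr
      _ = _ := by ring

/-- **Monotonicity of the p-Laplacian vector field, `p ≥ 2`:**
`(|a|^(p-2)a - |b|^(p-2)b)·(a - b) ≥ 2^(2-p)|a-b|^p`. -/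
theorem pLaplacian_vector_field_monotonicity
    (n : ℕ) (p : ℝ) (hp : 2 ≤ p) (a b : Euc n) :
    (2 : ℝ) ^ (2 - p) * ‖a - b‖ ^ p ≤
      ⟪‖a‖ ^ (p - 2) • a - ‖b‖ ^ (p - 2) • b, a - b⟫ := by
  simpa only [neg_sub, sub_add_cancel] using
    two_rpow_neg_mul_norm_sub_rpow_le_inner (sub_nonneg.2 hp) a b

end
end
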